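/- arXiv:1303.3424 — 2 statements merged into one kernel-verified Lean document; each statement's English description precedes it below -/
import Mathlib

section
/- Let 0<α<n and 1<p≤q<∞, and suppose the pair of weights (u,σ) satisfies [u,σ]_{A^α_{p,q}}<∞ and σ∈A_∞. Then ‖M_α(·σ)‖_{L^p(σ)→L^q(u)} ≤ C·[u,σ]_{A^α_{p,q}}·[σ]_{A^M_∞}^{1/q}, where C depends only on n, α, p and q. -/
open MeasureTheory ENNReal Set

noncomputable section

/-- `ℝ^n` with Lebesgue measure. -/
abbrev Rn (n : ℕ) : Type := Fin n → ℝ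

/-- An axis-parallel (half-open) cube in `ℝ^n`. -/
structure Cube (n : ℕ) where
  corner : Fin n → ℝ
  side : ℝ
  side_pos : 0 < side

/-- The underlying set of a cube. -/
def Cube.set {n : ℕ} (Q : Cube n) : Set (Rn n) :=
  {x | ∀ i, Q.corner i ≤ x i ∧ x i < Q.corner i + Q.side}

/-- The volume `|Q|` of a cube. -/
def Cube.vol {n : ℕ} (Q : Cube n) : ℝ := Q.side ^ n

/-- Conjugate exponent `p' = p/(p-1)`. -/
def conjExp (p : ℝ) : ℝ := p / (p - 1)

/-- Average over a cube of an `ℝ≥0∞`-valued function. -/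
def avgE {n : ℕ} (Q : Cube n) (g : Rn n → ℝ≥0∞) : ℝ≥0∞ :=
  (∫⁻ x in Q.set, g x) / ENNReal.ofReal Q.vol

/-- Average over a cube of a (nonnegative) real weight. -/
def avgW {n : ℕ} (Q : Cube n) (w : Rn n → ℝ) : ℝ≥0∞ :=
  avgE Q fun x => ENNReal.ofReal (w x)

/-- Weighted `L^p` norm `‖f‖_{L^p(w)}` of an `ℝ≥0∞`-valued function. -/
def LpW {n : ℕ} (f : Rn n → ℝ≥0∞) (p : ℝ) (w : Rn n → ℝ) : ℝ≥0∞ :=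
  (∫⁻ x, f x ^ p * ENNReal.ofReal (w x)) ^ (1 / p)

/-- Weighted weak `L^q` quasinorm `‖f‖_{L^{q,∞}(w)}`. -/
def WeakLpW {n : ℕ} (f : Rn n → ℝ≥0∞) (q : ℝ) (w : Rn n → ℝ) : ℝ≥0∞ :=
  ⨆ (t : ℝ) (_ : 0 < t),
    ENNReal.ofReal t *
      (∫⁻ x in {x | ENNReal.ofReal t < f x}, ENNReal.ofReal (w x)) ^ (1 / q)

/-- The fractional maximal operator `M_α`. -/
def fracMax {n : ℕ} (α : ℝ) (f : Rn n → ℝ≥0∞) (x : Rn n) : ℝ≥0∞ :=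
  ⨆ (Q : Cube n) (_ : x ∈ Q.set),
    ENNReal.ofReal (Q.vol ^ (α / n - 1)) * ∫⁻ y in Q.set, f y

/-- The Euclidean norm on `ℝ^n`. -/
def eucNorm {n : ℕ} (x : Rn n) : ℝ := Real.sqrt (∑ i, x i ^ 2)

/-- The Riesz potential `I_α`. -/
def riesz {n : ℕ} (α : ℝ) (f : Rn n → ℝ≥0∞) (x : Rn n) : ℝ≥0∞ :=
  ∫⁻ y, f y * ENNReal.ofReal (eucNorm (x - y) ^ (α - n))

/-- The product `fσ` of an `ℝ≥0∞`-valued function with a weight. -/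
def mulW {n : ℕ} (f : Rn n → ℝ≥0∞) (w : Rn n → ℝ) : Rn n → ℝ≥0∞ :=
  fun x => f x * ENNReal.ofReal (w x)

/-- The operator norm `‖T(·σ)‖_{L^p(σ) → L^q(u)}` (least admissible constant). -/
def opNormStrong {n : ℕ} (T : (Rn n → ℝ≥0∞) → Rn n → ℝ≥0∞) (p q : ℝ)
    (σ u : Rn n → ℝ) : ℝ≥0∞ :=
  ⨆ (f : Rn n → ℝ≥0∞) (_ : Measurable f), LpW (T (mulW f σ)) q u / LpW f p σ

/-- The weak-type operator norm `‖T(·σ)‖_{L^p(σ) → L^{q,∞}(u)}`. -/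
def opNormWeak {n : ℕ} (T : (Rn n → ℝ≥0∞) → Rn n → ℝ≥0∞) (p q : ℝ)
    (σ u : Rn n → ℝ) : ℝ≥0∞ :=
  ⨆ (f : Rn n → ℝ≥0∞) (_ : Measurable f), WeakLpW (T (mulW f σ)) q u / LpW f p σ

/-- The operator norm `‖T‖_{L^p(v) → L^q(u)}` (no multiplication by the weight). -/
def opNormPlain {n : ℕ} (T : (Rn n → ℝ≥0∞) → Rn n → ℝ≥0∞) (p q : ℝ)
    (v u : Rn n → ℝ) : ℝ≥0∞ :=
  ⨆ (f : Rn n → ℝ≥0∞) (_ : Measurable f), LpW (T f) q u / LpW f p v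

/-- The weak-type operator norm `‖T‖_{L^p(v) → L^{q,∞}(u)}`. -/
def opNormPlainWeak {n : ℕ} (T : (Rn n → ℝ≥0∞) → Rn n → ℝ≥0∞) (p q : ℝ)
    (v u : Rn n → ℝ) : ℝ≥0∞ :=
  ⨆ (f : Rn n → ℝ≥0∞) (_ : Measurable f), WeakLpW (T f) q u / LpW f p v

/-- A weight: a nonnegative locally integrable (measurable) function. -/
def IsWeight {n : ℕ} (w : Rn n → ℝ) : Prop :=
  Measurable w ∧ (∀ x, 0 ≤ w x) ∧ LocallyIntegrable w volume

/-- The local `A^α_{p,q}` functional `A^α_{p,q}(u,σ,Q)`. -/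
def ApqQ {n : ℕ} (α p q : ℝ) (u σ : Rn n → ℝ) (Q : Cube n) : ℝ≥0∞ :=
  ENNReal.ofReal (Q.vol ^ (α / n + 1 / q - 1 / p)) * avgW Q u ^ (1 / q) *
    avgW Q σ ^ (1 / conjExp p)

/-- The joint constant `[u,σ]_{A^α_{p,q}}`. -/
def Apq {n : ℕ} (α p q : ℝ) (u σ : Rn n → ℝ) : ℝ≥0∞ :=
  ⨆ Q : Cube n, ApqQ α p q u σ Q

/-- `A^α_{p,q}` for `ℝ≥0∞`-valued weights. -/
def ApqE {n : ℕ} (α p q : ℝ) (u σ : Rn n → ℝ≥0∞) : ℝ≥0∞ :=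
  ⨆ Q : Cube n,
    ENNReal.ofReal (Q.vol ^ (α / n + 1 / q - 1 / p)) * avgE Q u ^ (1 / q) *
      avgE Q σ ^ (1 / conjExp p)

/-- Real-valued average over a cube. -/
def avgR {n : ℕ} (Q : Cube n) (w : Rn n → ℝ) : ℝ := (∫ x in Q.set, w x) / Q.vol

/-- The local exponential `A_∞` functional `A^{exp}_∞(w,Q)`. -/
def AexpQ {n : ℕ} (Q : Cube n) (w : Rn n → ℝ) : ℝ :=
  avgR Q w * Real.exp (- avgR Q fun x => Real.log (w x))

/-- `w ∈ A_∞` (exponential definition). -/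
def IsAinf {n : ℕ} (w : Rn n → ℝ) : Prop :=
  ∃ C : ℝ, ∀ Q : Cube n,
    IntegrableOn (fun x => Real.log (w x)) Q.set volume ∧ AexpQ Q w ≤ C

/-- The local Fujii–Wilson functional `A^M_∞(w,Q) = w(Q)⁻¹ ∫_Q M(wχ_Q)`. -/
def FWQ {n : ℕ} (Q : Cube n) (w : Rn n → ℝ) : ℝ≥0∞ :=
  (∫⁻ x in Q.set, fracMax 0 (Q.set.indicator fun y => ENNReal.ofReal (w y)) x) /
    ∫⁻ x in Q.set, ENNReal.ofReal (w x)

/-- The Fujii–Wilson constant `[w]_{A^M_∞}`. -/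
def FW {n : ℕ} (w : Rn n → ℝ) : ℝ≥0∞ := ⨆ Q : Cube n, FWQ Q w

/-- The local Muckenhoupt `A_r` functional. -/
def ArQ {n : ℕ} (r : ℝ) (v : Rn n → ℝ) (Q : Cube n) : ℝ≥0∞ :=
  avgW Q v * (avgE Q fun x => ENNReal.ofReal (v x) ^ (1 - conjExp r)) ^ (r - 1)

/-- The Muckenhoupt constant `[v]_{A_r}`. -/
def ArC {n : ℕ} (r : ℝ) (v : Rn n → ℝ) : ℝ≥0∞ := ⨆ Q : Cube n, ArQ r v Q

/-- The mixed constant `[v]_{(A_r)^β (A^M_∞)^γ}`. -/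
def mixedC {n : ℕ} (r β γ : ℝ) (v : Rn n → ℝ) : ℝ≥0∞ :=
  ⨆ Q : Cube n, ArQ r v Q ^ β * FWQ Q v ^ γ

/-- `Φ(t) = 1 + log t` applied to an `ℝ≥0∞` constant. -/
def PhiLog (X : ℝ≥0∞) : ℝ≥0∞ :=
  if X = ∞ then ∞ else ENNReal.ofReal (1 + Real.log X.toReal)

/-- A Young function. -/
def IsYoung (Φ : ℝ → ℝ) : Prop :=
  ContinuousOn Φ (Ici 0) ∧ ConvexOn ℝ (Ici 0) Φ ∧ StrictMonoOn Φ (Ici 0) ∧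
    Φ 0 = 0 ∧ Filter.Tendsto (fun t => Φ t / t) Filter.atTop Filter.atTop

/-- The associate (conjugate) Young function `Φ̄(t) = sup_{s>0} (st - Φ(s))`. -/
def assocFn (Φ : ℝ → ℝ) (t : ℝ) : ℝ :=
  sSup {y : ℝ | ∃ s : ℝ, 0 < s ∧ y = s * t - Φ s}

/-- The localized Luxemburg average `‖f‖_{Φ,Q}`. -/
def luxNorm {n : ℕ} (Φ : ℝ → ℝ) (Q : Cube n) (f : Rn n → ℝ) : ℝ≥0∞ :=
  sInf ((fun l : ℝ => ENNReal.ofReal l) ''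
    {l : ℝ | 0 < l ∧
      (∫⁻ x in Q.set, ENNReal.ofReal (Φ (|f x| / l))) ≤ ENNReal.ofReal Q.vol})

/-- The fractional Orlicz maximal operator `M_{β,Φ}`. -/
def orliczMax {n : ℕ} (β : ℝ) (Φ : ℝ → ℝ) (f : Rn n → ℝ) (x : Rn n) : ℝ≥0∞ :=
  ⨆ (Q : Cube n) (_ : x ∈ Q.set), ENNReal.ofReal (Q.vol ^ (β / n)) * luxNorm Φ Q f

/-- Unweighted `L^p` norm of a real function. -/
def Lp0 {n : ℕ} (f : Rn n → ℝ) (p : ℝ) : ℝ≥0∞ :=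
  (∫⁻ x, ENNReal.ofReal |f x| ^ p) ^ (1 / p)

/-- Unweighted `L^p` norm of an `ℝ≥0∞`-valued function. -/
def LpE {n : ℕ} (g : Rn n → ℝ≥0∞) (p : ℝ) : ℝ≥0∞ :=
  (∫⁻ x, g x ^ p) ^ (1 / p)

/-- The unweighted operator norm `‖M_{β,Φ}‖_{L^p → L^q}`. -/
def orliczMaxNorm (n : ℕ) (β : ℝ) (Φ : ℝ → ℝ) (p q : ℝ) : ℝ≥0∞ :=
  ⨆ (f : Rn n → ℝ) (_ : Measurable f), LpE (orliczMax β Φ f) q / Lp0 f p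

/-- The `B^β_p` integral `∫_c^∞ Φ(t)^{q/p} t^{-q} dt/t`, where `1/q = 1/p - β/n`. -/
def BInt (Φ : ℝ → ℝ) (p q : ℝ) (c : ℝ) : ℝ≥0∞ :=
  ∫⁻ t in Ioi c, ENNReal.ofReal (Φ t ^ (q / p) * t ^ (-q) / t)

/-- The `B^β_p` condition (with `q` given by `1/q = 1/p - β/n`). -/
def BCond (Φ : ℝ → ℝ) (p q : ℝ) : Prop := ∃ c : ℝ, 0 < c ∧ BInt Φ p q c < ∞

/-- The bump constant `[u,σ]_{A^α_{p,q,Φ}}`. -/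
def bumpA {n : ℕ} (α p q : ℝ) (Φ : ℝ → ℝ) (u σ : Rn n → ℝ) : ℝ≥0∞ :=
  ⨆ Q : Cube n,
    ENNReal.ofReal (Q.vol ^ (α / n + 1 / q - 1 / p)) * avgW Q u ^ (1 / q) *
      luxNorm Φ Q (fun x => σ x ^ (1 / conjExp p))

/-- A dyadic grid in `ℝ^n`. -/
def IsDyadicGrid {n : ℕ} (D : Set (Cube n)) : Prop :=
  (∀ Q ∈ D, ∃ k : ℤ, Q.side = (2 : ℝ) ^ k) ∧
  (∀ Q ∈ D, ∀ P ∈ D, Q.set ∩ P.set = P.set ∨ Q.set ∩ P.set = Q.set ∨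
    Q.set ∩ P.set = ∅) ∧
  (∀ k : ℤ, ∀ x : Rn n, ∃! Q : Cube n, Q ∈ D ∧ Q.side = (2 : ℝ) ^ k ∧ x ∈ Q.set)

/-- The outer dyadic Riesz potential `I_α^{Q₀}`. -/
def outerRiesz {n : ℕ} (D : Set (Cube n)) (α : ℝ) (Q₀ : Cube n)
    (f : Rn n → ℝ≥0∞) (x : Rn n) : ℝ≥0∞ :=
  ∑' Q : {Q : Cube n // Q ∈ D ∧ Q₀.set ⊆ Q.set},
    Q.1.set.indicator
      (fun _ => ENNReal.ofReal (Q.1.vol ^ (α / n - 1)) * ∫⁻ y in Q.1.set, f y) x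

/-- The outer testing constant `[u,σ]_{I_α^{out},p,q}`. -/
def outerTest {n : ℕ} (D : Set (Cube n)) (α p q : ℝ) (u σ : Rn n → ℝ) : ℝ≥0∞ :=
  ⨆ (Q₀ : Cube n) (_ : Q₀ ∈ D),
    (∫⁻ x, outerRiesz D α Q₀ (Q₀.set.indicator fun y => ENNReal.ofReal (σ y)) x ^ q *
        ENNReal.ofReal (u x)) ^ (1 / q) /
      (∫⁻ x in Q₀.set, ENNReal.ofReal (σ x)) ^ (1 / p)

/-- The dyadic fractional maximal operator `M_α^𝒟`. -/
def dyadicFracMax {n : ℕ} (D : Set (Cube n)) (α : ℝ) (f : Rn n → ℝ≥0∞)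
    (x : Rn n) : ℝ≥0∞ :=
  ⨆ (Q : Cube n) (_ : Q ∈ D) (_ : x ∈ Q.set),
    ENNReal.ofReal (Q.vol ^ (α / n - 1)) * ∫⁻ y in Q.set, f y

/-- A sparse family `S ⊆ D` with associated disjoint thick subsets `E Q ⊆ Q`. -/
def IsSparse {n : ℕ} (D S : Set (Cube n)) (E : Cube n → Set (Rn n)) : Prop :=
  S ⊆ D ∧
  (∀ Q ∈ S, E Q ⊆ Q.set ∧ MeasurableSet (E Q) ∧
    ENNReal.ofReal Q.vol ≤ 2 * volume (E Q)) ∧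
  S.PairwiseDisjoint E

/-- The sparse operator `L_α^S`. -/
def sparseOp {n : ℕ} (S : Set (Cube n)) (E : Cube n → Set (Rn n)) (α : ℝ)
    (f : Rn n → ℝ≥0∞) (x : Rn n) : ℝ≥0∞ :=
  ∑' Q : S,
    (E Q.1).indicator
      (fun _ => ENNReal.ofReal (Q.1.vol ^ (α / n - 1)) * ∫⁻ y in Q.1.set, f y) x

/-- The one-dimensional fractional maximal operator over bounded intervals. -/
def fm1 (γ : ℝ) (f : ℝ → ℝ≥0∞) (x : ℝ) : ℝ≥0∞ :=
  ⨆ (a : ℝ) (b : ℝ) (_ : a < b) (_ : x ∈ Icc a b),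
    ENNReal.ofReal ((b - a) ^ (γ - 1)) * ∫⁻ y in Ioo a b, f y

section Laminar

variable {X : Type*}

/-- Any two members of the family are nested or disjoint. -/
def IsLaminar (F : Finset (Set X)) : Prop :=
  ∀ P ∈ F, ∀ Q ∈ F, P ⊆ Q ∨ Q ⊆ P ∨ Disjoint P Q

theorem IsLaminar.mono {F G : Finset (Set X)} (hF : IsLaminar F) (h : G ⊆ F) : IsLaminar G :=
  fun P hP Q hQ => hF P (h hP) Q (h hQ)

theorem IsLaminar.exists_disjoint_cover {F : Finset (Set X)} (hF : IsLaminar F) :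
    ∃ T ⊆ F, (T : Set (Set X)).PairwiseDisjoint id ∧ ∀ Q ∈ F, ∃ R ∈ T, Q ⊆ R := by
  classical
  refine ⟨F.filter (fun Q => Maximal (· ∈ F) Q), Finset.filter_subset _ _, ?_, ?_⟩
  · intro P hP Q hQ hne
    simp only [Finset.coe_filter, mem_ofPred_eq] at hP hQ
    rcases hF P hP.1 Q hQ.1 with h | h | h
    · exact absurd (hP.2.eq_of_le hQ.1 h) hne
    · exact absurd (hQ.2.eq_of_le hP.1 h).symm hne
    · exact h
  · intro Q hQ
    obtain ⟨R, hQR, hR⟩ := F.exists_le_maximal hQ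
    exact ⟨R, Finset.mem_filter.2 ⟨hR.1, hR⟩, hQR⟩

theorem sum_measure_le_of_pairwiseDisjoint [MeasurableSpace X] (ν : Measure X)
    {T : Finset (Set X)} (hd : (T : Set (Set X)).PairwiseDisjoint id)
    (hm : ∀ Q ∈ T, MeasurableSet Q) {B : Set X} (hB : ∀ Q ∈ T, Q ⊆ B) :
    ∑ Q ∈ T, ν Q ≤ ν B := by
  have h := measure_biUnion_finset (μ := ν) hd hm
  simp only [id] at h
  rw [← h]
  exact measure_mono (iUnion₂_subset hB)

open Classical in
/-- The members of the family whose strict ancestors all have strictly smaller level. -/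
def stopping (F : Finset (Set X)) (ℓ : Set X → ℤ) : Finset (Set X) :=
  F.filter fun Q => ∀ P ∈ F, Q ⊂ P → ℓ P < ℓ Q

theorem mem_stopping {F : Finset (Set X)} {ℓ : Set X → ℤ} {Q : Set X} :
    Q ∈ stopping F ℓ ↔ Q ∈ F ∧ ∀ P ∈ F, Q ⊂ P → ℓ P < ℓ Q := by
  simp [stopping]

theorem exists_stopping_superset {F : Finset (Set X)} (ℓ : Set X → ℤ) {Q : Set X} (hQ : Q ∈ F) :
    ∃ R ∈ stopping F ℓ, Q ⊆ R ∧ ℓ Q ≤ ℓ R := by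
  classical
  obtain ⟨R, -, hR⟩ := (F.filter fun P => Q ⊆ P ∧ ℓ Q ≤ ℓ P).exists_le_maximal
    (Finset.mem_filter.2 ⟨hQ, subset_rfl, le_rfl⟩)
  obtain ⟨hRF, hQR, hl⟩ := Finset.mem_filter.1 hR.1
  refine ⟨R, mem_stopping.2 ⟨hRF, fun P hP hRP => ?_⟩, hQR, hl⟩
  by_contra! h
  have := hR.eq_of_le (Finset.mem_filter.2 ⟨hP, hQR.trans hRP.subset, hl.trans h⟩) hRP.subset
  exact hRP.ne this

/-- The part of `Q` covered by members of `F` inside `Q` whose level is at least two higher. -/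
def highPart (F : Finset (Set X)) (ℓ : Set X → ℤ) (Q : Set X) : Set X :=
  ⋃ P ∈ {P ∈ (F : Set (Set X)) | P ⊆ Q ∧ ℓ Q + 2 ≤ ℓ P}, P

theorem measurableSet_highPart [MeasurableSpace X] {F : Finset (Set X)} (ℓ : Set X → ℤ)
    (hm : ∀ Q ∈ F, MeasurableSet Q) (Q : Set X) : MeasurableSet (highPart F ℓ Q) :=
  MeasurableSet.biUnion ((F.finite_toSet.subset (sep_subset _ _)).countable)
    fun P hP => hm P hP.1

open Classical in
theorem IsLaminar.card_stopping_le_two {F : Finset (Set X)} (hF : IsLaminar F) (ℓ : Set X → ℤ)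
    (x : X) : ((stopping F ℓ).filter fun Q => x ∈ Q \ highPart F ℓ Q).card ≤ 2 := by
  set G := (stopping F ℓ).filter fun Q => x ∈ Q \ highPart F ℓ Q with hG
  rcases G.eq_empty_or_nonempty with h | h
  · simp [h]
  have key : ∀ Q ∈ G, ∀ P ∈ G, ℓ P ≤ ℓ Q + 1 := by
    intro Q hQ P hP
    by_contra! hlt
    obtain ⟨hQS, hxQ, hxh⟩ := Finset.mem_filter.1 hQ
    obtain ⟨hPS, hxP, -⟩ := Finset.mem_filter.1 hP
    obtain ⟨hQF, -⟩ := mem_stopping.1 hQS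
    obtain ⟨hPF, hPm⟩ := mem_stopping.1 hPS
    have hPQ : P ⊆ Q := by
      rcases hF P hPF Q hQF with h | h | h
      · exact h
      · by_contra hn
        have := (mem_stopping.1 hQS).2 P hPF ⟨h, hn⟩
        omega
      · exact absurd hxQ (Set.disjoint_left.1 h hxP)
    exact hxh (mem_biUnion (show P ∈ _ from ⟨hPF, hPQ, by omega⟩) hxP)
  obtain ⟨Q₀, hQ₀, hmin⟩ := G.exists_min_image ℓ h
  refine (Finset.card_le_card_of_injOn (t := Finset.Icc (ℓ Q₀) (ℓ Q₀ + 1)) ℓ ?_ ?_).trans ?_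
  · intro Q hQ
    exact Finset.mem_coe.2 (Finset.mem_Icc.2 ⟨hmin Q hQ, key Q₀ hQ₀ Q hQ⟩)
  · intro P hP Q hQ hl
    obtain ⟨hQS, hxQ, -⟩ := Finset.mem_filter.1 (Finset.mem_coe.1 hQ)
    obtain ⟨hPS, hxP, -⟩ := Finset.mem_filter.1 (Finset.mem_coe.1 hP)
    obtain ⟨hQF, hQm⟩ := mem_stopping.1 hQS
    obtain ⟨hPF, hPm⟩ := mem_stopping.1 hPS
    rcases hF P hPF Q hQF with h | h | h
    · by_contra hne
      exact (hPm Q hQF (h.ssubset_of_ne hne)).ne' hl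
    · by_contra hne
      exact (hQm P hPF (h.ssubset_of_ne (Ne.symm hne))).ne hl
    · exact absurd hxQ (Set.disjoint_left.1 h hxP)
  · rw [Int.card_Icc]
    omega

/-- Sparsity of the stopping family: at most half of `Q` is covered by high levels. -/
theorem IsLaminar.measure_le_two_mul_diff_highPart [MeasurableSpace X] {F : Finset (Set X)}
    (hF : IsLaminar F) {m ν : Measure X} {γ : ℝ} (hγ : -1 ≤ γ)
    (hm : ∀ Q ∈ F, MeasurableSet Q) (hm0 : ∀ Q ∈ F, m Q ≠ 0) (hmt : ∀ Q ∈ F, m Q ≠ ∞)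
    {ℓ : Set X → ℤ} (hlow : ∀ Q ∈ F, (2 : ℝ≥0∞) ^ ℓ Q ≤ m Q ^ γ * ν Q)
    (hup : ∀ Q ∈ F, m Q ^ γ * ν Q ≤ (2 : ℝ≥0∞) ^ (ℓ Q + 1)) {Q : Set X} (hQ : Q ∈ F) :
    m Q ≤ 2 * m (Q \ highPart F ℓ Q) := by
  classical
  have hlamT : IsLaminar (F.filter fun P => P ⊆ Q ∧ ℓ Q + 2 ≤ ℓ P) :=
    hF.mono (Finset.filter_subset _ _)
  obtain ⟨T, hTF, hTd, hTc⟩ := hlamT.exists_disjoint_cover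
  have hT : ∀ P ∈ T, P ∈ F ∧ P ⊆ Q ∧ ℓ Q + 2 ≤ ℓ P := fun P hP => by
    simpa using hTF hP
  have two_ne : (2 : ℝ≥0∞) ^ (ℓ Q + 1) ≠ 0 := (ENNReal.zpow_pos (by simp) (by simp) _).ne'
  have two_nt : (2 : ℝ≥0∞) ^ (ℓ Q + 1) ≠ ∞ := (ENNReal.zpow_lt_top (by simp) (by simp) _).ne
  have hsplit : ∀ P ∈ F, m P ^ (1 + γ) * ν P = m P * (m P ^ γ * ν P) := fun P hP => by
    rw [ENNReal.rpow_add _ _ (hm0 P hP) (hmt P hP), ENNReal.rpow_one, mul_assoc]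
  have hhigh : highPart F ℓ Q ⊆ ⋃ P ∈ T, P := by
    refine iUnion₂_subset fun P hP => ?_
    obtain ⟨R, hR, hPR⟩ := hTc P (by simpa using hP)
    exact hPR.trans (subset_biUnion_of_mem (u := fun P : Set X => P) hR)
  have hsum : 2 * m (highPart F ℓ Q) ≤ m Q := by
    have h1 : (2 * m (highPart F ℓ Q)) * 2 ^ (ℓ Q + 1) ≤ m Q * 2 ^ (ℓ Q + 1) := by
      calc (2 * m (highPart F ℓ Q)) * 2 ^ (ℓ Q + 1)
          = m (highPart F ℓ Q) * 2 ^ (ℓ Q + 2) := by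
            rw [show ℓ Q + 2 = (ℓ Q + 1) + 1 by ring,
              ENNReal.zpow_add (x := 2) (by simp) (by simp) (ℓ Q + 1) 1, zpow_one]; ring
        _ ≤ (∑ P ∈ T, m P) * 2 ^ (ℓ Q + 2) := by
            gcongr
            exact (measure_mono hhigh).trans (measure_biUnion_finset_le _ _)
        _ = ∑ P ∈ T, m P * 2 ^ (ℓ Q + 2) := Finset.sum_mul _ _ _
        _ ≤ ∑ P ∈ T, m Q ^ (1 + γ) * ν P := by
            refine Finset.sum_le_sum fun P hP => ?_
            obtain ⟨hPF, hPQ, hl⟩ := hT P hP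
            calc m P * 2 ^ (ℓ Q + 2) ≤ m P * 2 ^ ℓ P := by
                  gcongr
                  · norm_num
              _ ≤ m P * (m P ^ γ * ν P) := by gcongr; exact hlow P hPF
              _ = m P ^ (1 + γ) * ν P := (hsplit P hPF).symm
              _ ≤ m Q ^ (1 + γ) * ν P := by
                  exact mul_le_mul' (ENNReal.rpow_le_rpow (measure_mono hPQ) (by linarith)) le_rfl
        _ = m Q ^ (1 + γ) * ∑ P ∈ T, ν P := (Finset.mul_sum _ _ _).symm
        _ ≤ m Q ^ (1 + γ) * ν Q := by
            gcongr
            exact sum_measure_le_of_pairwiseDisjoint ν hTd (fun P hP => hm P (hT P hP).1)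
              fun P hP => (hT P hP).2.1
        _ = m Q * (m Q ^ γ * ν Q) := hsplit Q hQ
        _ ≤ m Q * 2 ^ (ℓ Q + 1) := by gcongr; exact hup Q hQ
    exact (ENNReal.mul_le_mul_iff_left two_ne two_nt).1 h1
  have hsub : highPart F ℓ Q ⊆ Q := iUnion₂_subset fun P hP => hP.2.1
  have hdec : m Q = m (highPart F ℓ Q) + m (Q \ highPart F ℓ Q) := by
    rw [← measure_inter_add_sdiff Q (measurableSet_highPart ℓ hm Q),
      inter_eq_self_of_subset_right hsub]
  have hfin : m (highPart F ℓ Q) ≠ ∞ := ne_top_of_le_ne_top (hmt Q hQ) (measure_mono hsub)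
  rw [hdec, two_mul] at hsum
  have h2 := (ENNReal.add_le_add_iff_left hfin).1 hsum
  calc m Q = m (highPart F ℓ Q) + m (Q \ highPart F ℓ Q) := hdec
    _ ≤ 2 * m (Q \ highPart F ℓ Q) := by rw [two_mul]; gcongr

open Classical in
/-- The Carleson packing condition for the stopping family. -/
theorem IsLaminar.sum_stopping_le [MeasurableSpace X] {F : Finset (Set X)}
    (hF : IsLaminar F) {m ν W : Measure X} {γ : ℝ} (hγ : -1 ≤ γ)
    (hm : ∀ Q ∈ F, MeasurableSet Q) (hm0 : ∀ Q ∈ F, m Q ≠ 0) (hmt : ∀ Q ∈ F, m Q ≠ ∞)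
    {ℓ : Set X → ℤ} (hlow : ∀ Q ∈ F, (2 : ℝ≥0∞) ^ ℓ Q ≤ m Q ^ γ * ν Q)
    (hup : ∀ Q ∈ F, m Q ^ γ * ν Q ≤ (2 : ℝ≥0∞) ^ (ℓ Q + 1)) (R : Set X) :
    ∑ Q ∈ (stopping F ℓ).filter (· ⊆ R), W Q ≤
      4 * ∫⁻ x in R, ⨆ Q ∈ F, ⨆ (_ : Q ⊆ R), Q.indicator (fun _ => W Q / m Q) x ∂m := by
  set S := (stopping F ℓ).filter (· ⊆ R) with hS
  have hSF : ∀ Q ∈ S, Q ∈ F ∧ Q ⊆ R := fun Q hQ =>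
    ⟨(mem_stopping.1 (Finset.mem_filter.1 hQ).1).1, (Finset.mem_filter.1 hQ).2⟩
  have hE : ∀ Q ∈ S, MeasurableSet (Q \ highPart F ℓ Q) := fun Q hQ =>
    (hm Q (hSF Q hQ).1).diff (measurableSet_highPart ℓ hm Q)
  calc ∑ Q ∈ S, W Q ≤ ∑ Q ∈ S, 2 * ∫⁻ x in R,
        (Q \ highPart F ℓ Q).indicator (fun _ => W Q / m Q) x ∂m := by
        refine Finset.sum_le_sum fun Q hQ => ?_
        obtain ⟨hQF, hQR⟩ := hSF Q hQ
        rw [lintegral_indicator_const (hE Q hQ), Measure.restrict_apply (hE Q hQ),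
          inter_eq_self_of_subset_left (sdiff_subset.trans hQR)]
        calc W Q = W Q / m Q * m Q := (ENNReal.div_mul_cancel (hm0 Q hQF) (hmt Q hQF)).symm
          _ ≤ W Q / m Q * (2 * m (Q \ highPart F ℓ Q)) := by
            gcongr
            exact hF.measure_le_two_mul_diff_highPart hγ hm hm0 hmt hlow hup hQF
          _ = 2 * (W Q / m Q * m (Q \ highPart F ℓ Q)) := by ring
    _ = 2 * ∫⁻ x in R, ∑ Q ∈ S, (Q \ highPart F ℓ Q).indicator (fun _ => W Q / m Q) x ∂m := by
        rw [lintegral_finsetSum S fun Q hQ => measurable_const.indicator (hE Q hQ), Finset.mul_sum]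
    _ ≤ 2 * ∫⁻ x in R, 2 * ⨆ Q ∈ F, ⨆ (_ : Q ⊆ R), Q.indicator (fun _ => W Q / m Q) x ∂m := by
        gcongr with x
        set g := ⨆ Q ∈ F, ⨆ (_ : Q ⊆ R), Q.indicator (fun _ => W Q / m Q) x with hg
        calc ∑ Q ∈ S, (Q \ highPart F ℓ Q).indicator (fun _ => W Q / m Q) x
            = ∑ Q ∈ S.filter (fun Q => x ∈ Q \ highPart F ℓ Q), W Q / m Q := by
              rw [Finset.sum_filter (s := S)]
              exact Finset.sum_congr rfl fun Q _ => indicator_apply _ _ _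
          _ ≤ ∑ Q ∈ S.filter (fun Q => x ∈ Q \ highPart F ℓ Q), g := by
              refine Finset.sum_le_sum fun Q hQ => ?_
              obtain ⟨hQS, hxQ, -⟩ := Finset.mem_filter.1 hQ
              obtain ⟨hQF, hQR⟩ := hSF Q hQS
              refine le_trans ?_ (le_iSup₂_of_le Q hQF (le_iSup_of_le hQR le_rfl))
              rw [indicator_of_mem hxQ]
          _ = (S.filter (fun Q => x ∈ Q \ highPart F ℓ Q)).card * g := by
              rw [Finset.sum_const, nsmul_eq_mul]
          _ ≤ 2 * g := by
              gcongr
              refine le_trans ?_ (Nat.cast_le.2 (hF.card_stopping_le_two ℓ x))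
              gcongr
              exact Finset.filter_subset _ _
    _ = 4 * ∫⁻ x in R, ⨆ Q ∈ F, ⨆ (_ : Q ⊆ R), Q.indicator (fun _ => W Q / m Q) x ∂m := by
        rw [lintegral_const_mul' _ _ (by simp), ← mul_assoc]
        norm_num

end Laminar

section Embedding

theorem ENNReal.tsum_zpow_rpow_le {s : ℝ} (hs : 0 < s) :
    ∃ C : ℝ≥0∞, C ≠ ∞ ∧ ∀ y : ℝ≥0∞,
      ∑' j : ℤ, (if (2 : ℝ≥0∞) ^ j < y then ((2 : ℝ≥0∞) ^ j) ^ s else 0) ≤ C * y ^ s := by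
  have hr : (2 : ℝ≥0∞) ^ (-s) < 1 := ENNReal.rpow_lt_one_of_one_lt_of_neg (by simp) (by linarith)
  refine ⟨(1 - 2 ^ (-s))⁻¹, ENNReal.inv_ne_top.2 (tsub_pos_of_lt hr).ne', fun y => ?_⟩
  rcases eq_or_ne y 0 with rfl | hy0
  · simp
  rcases eq_or_ne y ∞ with rfl | hyt
  · rw [ENNReal.top_rpow_of_pos hs, ENNReal.mul_top]
    · exact le_top
    · exact (ENNReal.inv_pos.2 (by simp)).ne'
  obtain ⟨J, hJ, hJ'⟩ := ENNReal.exists_mem_Ioc_zpow hy0 hyt (y := 2) (by simp) (by simp)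
  have hinj : Function.Injective fun i : ℕ => J - (i : ℤ) := fun a b h => by
    simpa using h
  rw [← hinj.tsum_eq]
  · calc ∑' i : ℕ, (if (2 : ℝ≥0∞) ^ (J - (i : ℤ)) < y then ((2 : ℝ≥0∞) ^ (J - (i : ℤ))) ^ s else 0)
        ≤ ∑' i : ℕ, ((2 : ℝ≥0∞) ^ J) ^ s * (2 ^ (-s)) ^ i := by
          refine ENNReal.tsum_le_tsum fun i => ?_
          split_ifs
          · refine le_of_eq ?_
            rw [sub_eq_add_neg, ENNReal.zpow_add (by simp) (by simp),
              ENNReal.mul_rpow_of_nonneg _ _ hs.le, ENNReal.zpow_neg, zpow_natCast,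
              ENNReal.inv_rpow, ← ENNReal.rpow_natCast, ← ENNReal.rpow_natCast,
              ← ENNReal.rpow_mul, ← ENNReal.rpow_mul, ← ENNReal.rpow_neg]
            congr 2
            ring
          · exact zero_le
      _ = ((2 : ℝ≥0∞) ^ J) ^ s * (1 - 2 ^ (-s))⁻¹ := by
          rw [ENNReal.tsum_mul_left, ENNReal.tsum_geometric]
      _ ≤ (1 - 2 ^ (-s))⁻¹ * y ^ s := by
          rw [mul_comm]
          gcongr
  · intro j hj
    have hlt : (2 : ℝ≥0∞) ^ j < y := by
      by_contra h
      exact hj (if_neg h)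
    have hjJ : j ≤ J := by
      by_contra! h
      exact (hlt.trans_le hJ').not_ge (ENNReal.zpow_le_of_le (by norm_num) (by omega))
    exact ⟨(J - j).toNat, by simp [Int.toNat_of_nonneg (sub_nonneg.2 hjJ)]⟩

open Classical in
/-- Dyadic interpolation: weak-type bounds with truncated right-hand sides give a strong bound. -/
theorem exists_sum_rpow_mul_le {p : ℝ} (hp : 1 < p) :
    ∃ C : ℝ≥0∞, C ≠ ∞ ∧ ∀ {X ι : Type} [MeasurableSpace X] (W : Measure X) (S : Finset ι)
      (b w : ι → ℝ≥0∞) (K : ℝ≥0∞) (f : X → ℝ≥0∞), Measurable f → (∀ i ∈ S, b i ≠ ∞) →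
      (∀ j : ℤ, ∑ i ∈ S.filter (fun i => (2 : ℝ≥0∞) ^ (j + 1) < b i), w i ≤
        K * ((2 : ℝ≥0∞) ^ j)⁻¹ * ∫⁻ x, {x | (2 : ℝ≥0∞) ^ j < f x}.indicator f x ∂W) →
      ∑ i ∈ S, b i ^ p * w i ≤ C * K * ∫⁻ x, f x ^ p ∂W := by
  obtain ⟨C, hC, hsum⟩ := ENNReal.tsum_zpow_rpow_le (s := p - 1) (by linarith)
  refine ⟨4 ^ p * C, ENNReal.mul_ne_top (ENNReal.rpow_ne_top_of_nonneg (by linarith) (by simp)) hC,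
    fun {X ι} _ W S b w K f hf hb hweak => ?_⟩
  have hp0 : 0 < p := by linarith
  have h2 : ∀ j : ℤ, (2 : ℝ≥0∞) ^ j ≠ 0 := fun j => (ENNReal.zpow_pos (by simp) (by simp) j).ne'
  have h2t : ∀ j : ℤ, (2 : ℝ≥0∞) ^ j ≠ ∞ := fun j => (ENNReal.zpow_lt_top (by simp) (by simp) j).ne
  have hms : ∀ j : ℤ, MeasurableSet {x | (2 : ℝ≥0∞) ^ j < f x} := fun j =>
    measurableSet_lt measurable_const hf
  have hpt : ∀ i ∈ S, b i ^ p ≤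
      ∑' j : ℤ, if (2 : ℝ≥0∞) ^ (j + 1) < b i then 4 ^ p * ((2 : ℝ≥0∞) ^ j) ^ p else 0 := by
    intro i hi
    rcases eq_or_ne (b i) 0 with h0 | h0
    · simp [h0, hp0]
    obtain ⟨J, hJ, hJ'⟩ := ENNReal.exists_mem_Ioc_zpow h0 (hb i hi) (y := 2) (by simp) (by simp)
    refine le_trans ?_ (ENNReal.le_tsum (J - 1))
    rw [if_pos (by simpa using hJ), ← ENNReal.mul_rpow_of_nonneg _ _ hp0.le]
    refine ENNReal.rpow_le_rpow (hJ'.trans_eq ?_) hp0.le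
    rw [show J + 1 = (J - 1) + 2 by ring, ENNReal.zpow_add (by simp) (by simp), mul_comm]
    norm_num
  calc ∑ i ∈ S, b i ^ p * w i
      ≤ ∑ i ∈ S, ∑' j : ℤ,
          (if (2 : ℝ≥0∞) ^ (j + 1) < b i then 4 ^ p * ((2 : ℝ≥0∞) ^ j) ^ p else 0) * w i := by
        refine Finset.sum_le_sum fun i hi => ?_
        rw [ENNReal.tsum_mul_right]
        gcongr
        exact hpt i hi
    _ = ∑' j : ℤ, ∑ i ∈ S,
          (if (2 : ℝ≥0∞) ^ (j + 1) < b i then 4 ^ p * ((2 : ℝ≥0∞) ^ j) ^ p else 0) * w i :=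
        (Summable.tsum_finsetSum fun _ _ => ENNReal.summable).symm
    _ = ∑' j : ℤ, 4 ^ p * ((2 : ℝ≥0∞) ^ j) ^ p *
          ∑ i ∈ S.filter (fun i => (2 : ℝ≥0∞) ^ (j + 1) < b i), w i := by
        refine tsum_congr fun j => ?_
        rw [Finset.mul_sum, Finset.sum_filter]
        refine Finset.sum_congr rfl fun i _ => ?_
        split_ifs <;> simp
    _ ≤ ∑' j : ℤ, 4 ^ p * ((2 : ℝ≥0∞) ^ j) ^ p *
          (K * ((2 : ℝ≥0∞) ^ j)⁻¹ * ∫⁻ x, {x | (2 : ℝ≥0∞) ^ j < f x}.indicator f x ∂W) := by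
        gcongr with j
        exact hweak j
    _ = ∑' j : ℤ, 4 ^ p * K * ∫⁻ x, f x *
          (if (2 : ℝ≥0∞) ^ j < f x then ((2 : ℝ≥0∞) ^ j) ^ (p - 1) else 0) ∂W := by
        refine tsum_congr fun j => ?_
        have hx : ∀ x, f x * (if (2 : ℝ≥0∞) ^ j < f x then ((2 : ℝ≥0∞) ^ j) ^ (p - 1) else 0) =
            ((2 : ℝ≥0∞) ^ j) ^ (p - 1) * {x | (2 : ℝ≥0∞) ^ j < f x}.indicator f x := fun x => by
          by_cases h : (2 : ℝ≥0∞) ^ j < f x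
          · simp [h, mul_comm]
          · simp [h]
        simp_rw [hx]
        rw [lintegral_const_mul _ (hf.indicator (hms j)), ENNReal.rpow_sub _ _ (h2 j) (h2t j),
          ENNReal.rpow_one, div_eq_mul_inv]
        ring
    _ = 4 ^ p * K * ∫⁻ x, f x *
          ∑' j : ℤ, (if (2 : ℝ≥0∞) ^ j < f x then ((2 : ℝ≥0∞) ^ j) ^ (p - 1) else 0) ∂W := by
        rw [ENNReal.tsum_mul_left, ← lintegral_tsum]
        · simp_rw [ENNReal.tsum_mul_left]
        · exact fun j => (hf.mul (Measurable.ite (hms j) measurable_const measurable_const)).aemeasurable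
    _ ≤ 4 ^ p * K * ∫⁻ x, C * f x ^ p ∂W := by
        refine mul_le_mul' le_rfl (lintegral_mono fun x => ?_)
        calc f x * ∑' j : ℤ, (if (2 : ℝ≥0∞) ^ j < f x then ((2 : ℝ≥0∞) ^ j) ^ (p - 1) else 0)
            ≤ f x * (C * f x ^ (p - 1)) := by gcongr; exact hsum (f x)
          _ = C * (f x ^ (1 : ℝ) * f x ^ (p - 1)) := by rw [ENNReal.rpow_one]; ring
          _ = C * f x ^ p := by
            rw [← ENNReal.rpow_add_of_nonneg _ _ zero_le_one (by linarith)]; simp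
    _ = 4 ^ p * C * K * ∫⁻ x, f x ^ p ∂W := by
        rw [lintegral_const_mul' _ _ hC]; ring

end Embedding

section Core

open Classical in
/-- Carleson embedding for the averages of `f` over the stopping family. -/
theorem exists_sum_stopping_average_le {p : ℝ} (hp : 1 < p) :
    ∃ C : ℝ≥0∞, C ≠ ∞ ∧ ∀ {X : Type} [MeasurableSpace X] (W : Measure X) (S : Finset (Set X))
      (K : ℝ≥0∞) (f : X → ℝ≥0∞), Measurable f → IsLaminar S → (∀ Q ∈ S, MeasurableSet Q) →
      (∀ Q ∈ S, W Q ≠ 0) → (∀ Q ∈ S, W Q ≠ ∞) → (∀ Q ∈ S, ∫⁻ x in Q, f x ∂W ≠ ∞) →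
      (∀ R ∈ S, ∑ Q ∈ S.filter (· ⊆ R), W Q ≤ K * W R) →
      ∑ Q ∈ S, ((∫⁻ x in Q, f x ∂W) / W Q) ^ p * W Q ≤ C * K * ∫⁻ x, f x ^ p ∂W := by
  obtain ⟨C, hC, h⟩ := exists_sum_rpow_mul_le hp
  refine ⟨C, hC, fun {X} _ W S K f hf hS hm hW0 hWt hft hcar => ?_⟩
  refine h W S _ W K f hf (fun Q hQ => (ENNReal.div_lt_top (hft Q hQ) (hW0 Q hQ)).ne) fun j => ?_
  have h2 : (2 : ℝ≥0∞) ^ j ≠ 0 := (ENNReal.zpow_pos (by simp) (by simp) j).ne'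
  have h2t : (2 : ℝ≥0∞) ^ j ≠ ∞ := (ENNReal.zpow_lt_top (by simp) (by simp) j).ne
  set g := {x | (2 : ℝ≥0∞) ^ j < f x}.indicator f with hg
  have hgm : Measurable g := hf.indicator (measurableSet_lt measurable_const hf)
  set S' := S.filter fun Q => (2 : ℝ≥0∞) ^ (j + 1) < (∫⁻ x in Q, f x ∂W) / W Q with hS'
  have hS'S : S' ⊆ S := Finset.filter_subset _ _
  obtain ⟨T, hTS, hTd, hTc⟩ := (hS.mono hS'S).exists_disjoint_cover
  have hlarge : ∀ R ∈ T, W R ≤ ((2 : ℝ≥0∞) ^ j)⁻¹ * ∫⁻ x in R, g x ∂W := by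
    intro R hR
    obtain ⟨hRS, hRl⟩ := Finset.mem_filter.1 (hTS hR)
    have h1 : (2 : ℝ≥0∞) ^ (j + 1) * W R ≤ ∫⁻ x in R, f x ∂W :=
      (ENNReal.le_div_iff_mul_le (Or.inl (hW0 R hRS)) (Or.inl (hWt R hRS))).1 hRl.le
    have h3 : ∫⁻ x in R, f x ∂W ≤ 2 ^ j * W R + ∫⁻ x in R, g x ∂W := by
      calc ∫⁻ x in R, f x ∂W ≤ ∫⁻ x in R, (2 ^ j + g x) ∂W := by
            refine lintegral_mono fun x => ?_
            by_cases hx : (2 : ℝ≥0∞) ^ j < f x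
            · simp [hg, hx]
            · exact (not_lt.1 hx).trans le_self_add
        _ = _ := by rw [lintegral_add_left measurable_const, setLIntegral_const]
    have h4 : (2 : ℝ≥0∞) ^ j * W R ≤ ∫⁻ x in R, g x ∂W := by
      refine (ENNReal.add_le_add_iff_left (ENNReal.mul_ne_top h2t (hWt R hRS))).1
        (le_trans (le_of_eq ?_) (h1.trans h3))
      rw [ENNReal.zpow_add (by simp) (by simp), zpow_one]
      ring
    calc W R = ((2 : ℝ≥0∞) ^ j)⁻¹ * (2 ^ j * W R) := by
          rw [← mul_assoc, ENNReal.inv_mul_cancel h2 h2t, one_mul]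
      _ ≤ _ := by gcongr
  calc ∑ Q ∈ S', W Q ≤ ∑ Q ∈ S', ∑ R ∈ T, if Q ⊆ R then W Q else 0 := by
        refine Finset.sum_le_sum fun Q hQ => ?_
        obtain ⟨R, hR, hQR⟩ := hTc Q hQ
        refine le_trans ?_ (Finset.single_le_sum (fun _ _ => zero_le) hR)
        rw [if_pos hQR]
    _ = ∑ R ∈ T, ∑ Q ∈ S'.filter (· ⊆ R), W Q := by
        rw [Finset.sum_comm]
        simp_rw [Finset.sum_filter]
    _ ≤ ∑ R ∈ T, ∑ Q ∈ S.filter (· ⊆ R), W Q := by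
        refine Finset.sum_le_sum fun R _ => Finset.sum_le_sum_of_subset ?_
        exact Finset.filter_subset_filter _ hS'S
    _ ≤ ∑ R ∈ T, K * (((2 : ℝ≥0∞) ^ j)⁻¹ * ∫⁻ x in R, g x ∂W) := by
        refine Finset.sum_le_sum fun R hR => (hcar R (hS'S (hTS hR))).trans ?_
        gcongr
        exact hlarge R hR
    _ = K * ((2 : ℝ≥0∞) ^ j)⁻¹ * ∑ R ∈ T, W.withDensity g R := by
        rw [Finset.mul_sum]
        refine Finset.sum_congr rfl fun R hR => ?_
        rw [withDensity_apply _ (hm R (hS'S (hTS hR))), mul_assoc]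
    _ ≤ K * ((2 : ℝ≥0∞) ^ j)⁻¹ * ∫⁻ x, g x ∂W := by
        gcongr
        refine (sum_measure_le_of_pairwiseDisjoint _ hTd (fun R hR => hm R (hS'S (hTS hR)))
          fun R _ => subset_univ R).trans_eq ?_
        rw [withDensity_apply _ MeasurableSet.univ, Measure.restrict_univ]

theorem setLIntegral_le_lintegral_rpow_mul_measure {X : Type*} [MeasurableSpace X] (W : Measure X)
    {p : ℝ} (hp : 1 < p) {f : X → ℝ≥0∞} (hf : Measurable f) (Q : Set X) :
    ∫⁻ x in Q, f x ∂W ≤ (∫⁻ x, f x ^ p ∂W) ^ (1 / p) * W Q ^ (1 - 1 / p) := by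
  have hc : p.HolderConjugate (Real.conjExponent p) := Real.HolderConjugate.conjExponent hp
  have h := ENNReal.lintegral_mul_le_Lp_mul_Lq (W.restrict Q) hc hf.aemeasurable
    (g := fun _ => 1) aemeasurable_const
  simp only [Pi.mul_apply, mul_one, ENNReal.one_rpow, lintegral_const, Measure.restrict_apply_univ,
    one_mul] at h
  refine h.trans ?_
  rw [one_div, one_div, ← hc.one_sub_inv]
  refine mul_le_mul' (ENNReal.rpow_le_rpow (setLIntegral_le_lintegral _ _) ?_) le_rfl
  exact inv_nonneg.2 (by linarith)

/-- The two-weight bound for the maximal operator of a finite laminar family. -/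
theorem exists_lintegral_laminar_max_le {p q : ℝ} (hp : 1 < p) (hpq : p ≤ q) :
    ∃ C : ℝ≥0∞, C ≠ ∞ ∧ ∀ {X : Type} [MeasurableSpace X] (m U W : Measure X) (F : Finset (Set X))
      (γ : ℝ) (A K : ℝ≥0∞) (f : X → ℝ≥0∞), -1 ≤ γ → Measurable f → IsLaminar F →
      (∀ Q ∈ F, MeasurableSet Q) → (∀ Q ∈ F, m Q ≠ 0) → (∀ Q ∈ F, m Q ≠ ∞) →
      (∀ Q ∈ F, W Q ≠ ∞) → ∫⁻ x, f x ^ p ∂W ≠ ∞ →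
      (∀ Q ∈ F, m Q ^ γ * U Q ^ (1 / q) * W Q ^ (1 - 1 / p) ≤ A) →
      (∀ R ∈ F, ∫⁻ x in R, ⨆ Q ∈ F, ⨆ (_ : Q ⊆ R), Q.indicator (fun _ => W Q / m Q) x ∂m ≤
        K * W R) →
      ∫⁻ x, (⨆ Q ∈ F, Q.indicator (fun _ => m Q ^ γ * ∫⁻ y in Q, f y ∂W) x) ^ q ∂U ≤
        C * A ^ q * K * (∫⁻ x, f x ^ p ∂W) ^ (q / p) := by
  classical
  obtain ⟨C, hC, hemb⟩ := exists_sum_stopping_average_le hp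
  have hp0 : 0 < p := by linarith
  have hq0 : 0 < q := by linarith
  refine ⟨2 ^ q * (C * 4), ENNReal.mul_ne_top (ENNReal.rpow_ne_top_of_nonneg hq0.le (by simp))
    (ENNReal.mul_ne_top hC (by simp)), ?_⟩
  intro X _ m U W F γ A K f hγ hf hF hm hm0 hmt hWt hN hA hK
  set N := ∫⁻ x, f x ^ p ∂W with hNdef
  set lam : Set X → ℝ≥0∞ := fun Q => m Q ^ γ * ∫⁻ y in Q, f y ∂W with hlam
  have hint : ∀ Q ∈ F, ∫⁻ x in Q, f x ∂W ≤ N ^ (1 / p) * W Q ^ (1 - 1 / p) := fun Q _ =>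
    setLIntegral_le_lintegral_rpow_mul_measure W hp hf Q
  have h1p : 0 < 1 - 1 / p := by
    rw [sub_pos, div_lt_one hp0]
    exact hp
  have hintt : ∀ Q ∈ F, ∫⁻ x in Q, f x ∂W ≠ ∞ := fun Q hQ =>
    ne_top_of_le_ne_top (ENNReal.mul_ne_top (ENNReal.rpow_ne_top_of_nonneg (by positivity) hN)
      (ENNReal.rpow_ne_top_of_nonneg h1p.le (hWt Q hQ))) (hint Q hQ)
  have hlamt : ∀ Q ∈ F, lam Q ≠ ∞ := fun Q hQ =>
    ENNReal.mul_ne_top (ENNReal.rpow_ne_top_of_ne_zero (hm0 Q hQ) (hmt Q hQ)) (hintt Q hQ)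
  set G := F.filter fun Q => lam Q ≠ 0 with hG
  have hGF : G ⊆ F := Finset.filter_subset _ _
  have hlev : ∀ Q, ∃ l : ℤ, Q ∈ G → lam Q ∈ Ioc ((2 : ℝ≥0∞) ^ l) (2 ^ (l + 1)) := by
    intro Q
    by_cases hQ : Q ∈ G
    · obtain ⟨l, hl⟩ := ENNReal.exists_mem_Ioc_zpow (Finset.mem_filter.1 hQ).2
        (hlamt Q (hGF hQ)) (y := 2) (by simp) (by simp)
      exact ⟨l, fun _ => hl⟩
    · exact ⟨0, fun h => absurd h hQ⟩
  choose ℓ hℓ using hlev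
  set S := stopping G ℓ with hS
  have hSG : S ⊆ G := fun Q hQ => (mem_stopping.1 hQ).1
  have hSF : S ⊆ F := hSG.trans hGF
  have hW0 : ∀ Q ∈ G, W Q ≠ 0 := by
    intro Q hQ h0
    refine (Finset.mem_filter.1 hQ).2 ?_
    simp only [hlam]
    rw [setLIntegral_measure_zero _ _ h0, mul_zero]
  have hcar : ∀ R ∈ S, ∑ Q ∈ S.filter (· ⊆ R), W Q ≤ 4 * K * W R := by
    intro R hR
    have hν : ∀ Q ∈ G, m Q ^ γ * W.withDensity f Q = lam Q := fun Q hQ => by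
      rw [withDensity_apply _ (hm Q (hGF hQ))]
    refine ((hF.mono hGF).sum_stopping_le (m := m) (ν := W.withDensity f) hγ
      (fun Q hQ => hm Q (hGF hQ)) (fun Q hQ => hm0 Q (hGF hQ)) (fun Q hQ => hmt Q (hGF hQ))
      (fun Q hQ => (hℓ Q hQ).1.le.trans_eq (hν Q hQ).symm)
      (fun Q hQ => (hν Q hQ).trans_le (hℓ Q hQ).2) R).trans ?_
    rw [mul_assoc]
    gcongr
    refine le_trans (lintegral_mono fun x => ?_) (hK R (hSF hR))
    exact biSup_mono fun Q hQ => hGF hQ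
  have hbig := hemb W S (4 * K) f hf (hF.mono hSF) (fun Q hQ => hm Q (hSF hQ))
    (fun Q hQ => hW0 Q (hSG hQ)) (fun Q hQ => hWt Q (hSF hQ)) (fun Q hQ => hintt Q (hSF hQ)) hcar
  have hpt : ∀ x, (⨆ Q ∈ F, Q.indicator (fun _ => lam Q) x) ^ q ≤
      ∑ Q ∈ S, Q.indicator (fun _ => 2 ^ q * lam Q ^ q) x := by
    intro x
    rw [← ENNReal.le_rpow_inv_iff hq0]
    refine iSup₂_le fun Q hQ => ?_
    rw [ENNReal.le_rpow_inv_iff hq0]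
    by_cases hx : x ∈ Q
    swap
    · simp [hx, hq0]
    rw [indicator_of_mem hx]
    by_cases h0 : lam Q = 0
    · simp [h0, hq0]
    have hQG : Q ∈ G := Finset.mem_filter.2 ⟨hQ, h0⟩
    obtain ⟨R, hR, hQR, hle⟩ := exists_stopping_superset ℓ hQG
    refine le_trans ?_ (Finset.single_le_sum (fun _ _ => zero_le) hR)
    rw [indicator_of_mem (hQR hx), ← ENNReal.mul_rpow_of_nonneg _ _ hq0.le]
    refine ENNReal.rpow_le_rpow ?_ hq0.le
    calc lam Q ≤ 2 ^ (ℓ Q + 1) := (hℓ Q hQG).2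
      _ ≤ 2 ^ (ℓ R + 1) := ENNReal.zpow_le_of_le (by norm_num) (by omega)
      _ = 2 * 2 ^ ℓ R := by
        rw [ENNReal.zpow_add (by simp) (by simp), zpow_one, mul_comm]
      _ ≤ 2 * lam R := by gcongr; exact (hℓ R (hSG hR)).1.le
  have hterm : ∀ Q ∈ S, lam Q ^ q * U Q ≤
      A ^ q * N ^ (q / p - 1) * (((∫⁻ x in Q, f x ∂W) / W Q) ^ p * W Q) := by
    intro Q hQ
    have hw0 := hW0 Q (hSG hQ)
    have hwt := hWt Q (hSF hQ)
    set b := (∫⁻ x in Q, f x ∂W) / W Q with hb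
    have hbW : ∫⁻ x in Q, f x ∂W = W Q ^ (1 - 1 / p) * (b * W Q ^ (1 / p)) := by
      rw [mul_left_comm, ← ENNReal.rpow_add _ _ hw0 hwt, sub_add_cancel, ENNReal.rpow_one, hb,
        ENNReal.div_mul_cancel hw0 hwt]
    have hbN : b * W Q ^ (1 / p) ≤ N ^ (1 / p) := by
      have := hint Q (hSF hQ)
      rw [hbW, mul_comm (N ^ (1 / p))] at this
      exact (ENNReal.mul_le_mul_iff_right (ENNReal.rpow_pos (pos_iff_ne_zero.2 hw0) hwt).ne'
        (ENNReal.rpow_ne_top_of_ne_zero hw0 hwt)).1 this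
    calc lam Q ^ q * U Q
        = (m Q ^ γ * U Q ^ (1 / q) * W Q ^ (1 - 1 / p)) ^ q * (b * W Q ^ (1 / p)) ^ q := by
          rw [← ENNReal.mul_rpow_of_nonneg _ _ hq0.le]
          simp only [hlam]
          rw [hbW]
          rw [show m Q ^ γ * U Q ^ (1 / q) * W Q ^ (1 - 1 / p) * (b * W Q ^ (1 / p)) =
            m Q ^ γ * (W Q ^ (1 - 1 / p) * (b * W Q ^ (1 / p))) * U Q ^ (1 / q) by ring,
            ENNReal.mul_rpow_of_nonneg (_ * (_ * _)) (U Q ^ (1 / q)) hq0.le, ← ENNReal.rpow_mul (U Q),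
            one_div_mul_cancel hq0.ne', ENNReal.rpow_one]
      _ = (m Q ^ γ * U Q ^ (1 / q) * W Q ^ (1 - 1 / p)) ^ q *
          ((b * W Q ^ (1 / p)) ^ (q - p) * (b * W Q ^ (1 / p)) ^ p) := by
          rw [← ENNReal.rpow_add_of_nonneg _ _ (by linarith) hp0.le, sub_add_cancel]
      _ ≤ A ^ q * ((N ^ (1 / p)) ^ (q - p) * (b * W Q ^ (1 / p)) ^ p) := by
          gcongr
          exact hA Q (hSF hQ)
      _ = _ := by
          rw [← ENNReal.rpow_mul, ENNReal.mul_rpow_of_nonneg _ _ hp0.le, ← ENNReal.rpow_mul,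
            one_div_mul_cancel hp0.ne', ENNReal.rpow_one, mul_assoc]
          congr 3
          field_simp
  calc ∫⁻ x, (⨆ Q ∈ F, Q.indicator (fun _ => lam Q) x) ^ q ∂U
      ≤ ∫⁻ x, ∑ Q ∈ S, Q.indicator (fun _ => 2 ^ q * lam Q ^ q) x ∂U := lintegral_mono hpt
    _ = ∑ Q ∈ S, 2 ^ q * (lam Q ^ q * U Q) := by
        rw [lintegral_finsetSum _ fun Q hQ => measurable_const.indicator (hm Q (hSF hQ))]
        refine Finset.sum_congr rfl fun Q hQ => ?_
        rw [lintegral_indicator_const (hm Q (hSF hQ)), mul_assoc]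
    _ ≤ ∑ Q ∈ S, 2 ^ q * (A ^ q * N ^ (q / p - 1) *
          (((∫⁻ x in Q, f x ∂W) / W Q) ^ p * W Q)) := by
        exact Finset.sum_le_sum fun Q hQ => mul_le_mul' le_rfl (hterm Q hQ)
    _ = 2 ^ q * (A ^ q * N ^ (q / p - 1)) *
          ∑ Q ∈ S, ((∫⁻ x in Q, f x ∂W) / W Q) ^ p * W Q := by
        rw [Finset.mul_sum]
        refine Finset.sum_congr rfl fun Q _ => by ring
    _ ≤ 2 ^ q * (A ^ q * N ^ (q / p - 1)) * (C * (4 * K) * N) := by gcongr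
    _ = 2 ^ q * (C * 4) * A ^ q * K * (N ^ (q / p - 1) * N ^ (1 : ℝ)) := by
        rw [ENNReal.rpow_one]; ring
    _ = 2 ^ q * (C * 4) * A ^ q * K * N ^ (q / p) := by
        rw [← ENNReal.rpow_add_of_nonneg _ _ _ zero_le_one, sub_add_cancel]
        rw [sub_nonneg, le_div_iff₀ hp0]
        linarith

end Core

section Grid

/-- The offset of the `k`-th generation of a (possibly shifted) dyadic grid on the line, relative
to the side length. -/
def gridShift (t : Bool) (k : ℤ) : ℝ := if t then (-1) ^ k / 3 else 0

/-- The position of a real number in the `k`-th generation of the shifted dyadic grid. -/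
def gridIndex (t : Bool) (k : ℤ) (x : ℝ) : ℤ := ⌊x / 2 ^ k - gridShift t k⌋

theorem exists_gridIndex_succ (t : Bool) (k : ℤ) :
    ∃ c : ℤ, ∀ x, gridIndex t (k + 1) x = (gridIndex t k x + c) / 2 := by
  have h2 : (2 : ℝ) ^ k ≠ 0 := by positivity
  have key : ∀ (y : ℝ) (c : ℤ), ⌊(y + c) / 2⌋ = (⌊y⌋ + c) / 2 := fun y c => by
    have := Int.floor_div_natCast (y + c) 2
    rw [Int.floor_add_intCast] at this
    exact_mod_cast this
  cases t with
  | false =>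
    refine ⟨0, fun x => ?_⟩
    rw [gridIndex, gridIndex, ← key]
    congr 1
    simp only [gridShift, zpow_add_one₀ (two_ne_zero' ℝ), Bool.false_eq_true, if_false, sub_zero,
      Int.cast_zero, add_zero]
    field_simp
  | true =>
    obtain ⟨c, hc⟩ : ∃ c : ℤ, (c : ℝ) = (-1) ^ k := by
      rcases Int.even_or_odd k with h | h
      · exact ⟨1, by simp [h.neg_one_zpow]⟩
      · exact ⟨-1, by simp [h.neg_one_zpow]⟩
    refine ⟨c, fun x => ?_⟩
    rw [gridIndex, gridIndex, ← key]
    congr 1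
    simp only [gridShift, zpow_add_one₀ (two_ne_zero' ℝ),
      zpow_add_one₀ (neg_ne_zero.2 (one_ne_zero' ℝ)), if_true, hc]
    field_simp
    ring

theorem gridIndex_eq_of_le {t : Bool} {k k' : ℤ} (h : k ≤ k') {x y : ℝ}
    (hxy : gridIndex t k x = gridIndex t k y) : gridIndex t k' x = gridIndex t k' y := by
  induction k', h using Int.leInduction with
  | base => exact hxy
  | succ j hj ih =>
    obtain ⟨c, hc⟩ := exists_gridIndex_succ t j
    rw [hc, hc, ih]

/-- The one-third trick on the line. -/
theorem exists_gridIndex_const {k : ℤ} {a h : ℝ} (hk : 3 * h ≤ 2 ^ k) :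
    ∃ t, ∀ y, a ≤ y → y < a + h → gridIndex t k y = gridIndex t k a := by
  have h2 : (0 : ℝ) < 2 ^ k := by positivity
  by_contra! hcon
  have key : ∀ t, ∃ g : ℤ, a / 2 ^ k - gridShift t k < g ∧
      (g : ℝ) < a / 2 ^ k - gridShift t k + 1 / 3 := by
    intro t
    obtain ⟨y, hay, hyh, hne⟩ := hcon t
    have hyk : y / 2 ^ k < a / 2 ^ k + 1 / 3 := by
      rw [div_add' _ _ _ h2.ne', div_lt_div_iff_of_pos_right h2]
      linarith
    have hle : gridIndex t k a < gridIndex t k y :=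
      lt_of_le_of_ne (Int.floor_mono (by gcongr)) hne.symm
    refine ⟨gridIndex t k y, Int.floor_lt.1 hle, ?_⟩
    have := Int.floor_le (y / 2 ^ k - gridShift t k)
    rw [gridIndex]
    linarith
  obtain ⟨g, hg1, hg2⟩ := key false
  obtain ⟨g', hg1', hg2'⟩ := key true
  simp only [gridShift, if_true, Bool.false_eq_true, if_false] at hg1 hg2 hg1' hg2'
  rcases Int.even_or_odd k with hpar | hpar
  · rw [hpar.neg_one_zpow] at hg1' hg2'
    have l1 : (3 * (g - g') : ℝ) < ((2 : ℤ) : ℝ) := by push_cast; linarith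
    have l2 : ((0 : ℤ) : ℝ) < 3 * (g - g') := by push_cast; linarith
    have l1' : 3 * (g - g') < 2 := by exact_mod_cast l1
    have l2' : 0 < 3 * (g - g') := by exact_mod_cast l2
    omega
  · rw [hpar.neg_one_zpow] at hg1' hg2'
    have l1 : (3 * (g - g') : ℝ) < ((0 : ℤ) : ℝ) := by push_cast; linarith
    have l2 : ((-2 : ℤ) : ℝ) < 3 * (g - g') := by push_cast; linarith
    have l1' : 3 * (g - g') < 0 := by exact_mod_cast l1
    have l2' : -2 < 3 * (g - g') := by exact_mod_cast l2
    omega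

variable {n : ℕ}

/-- The cubes of the dyadic grid on `ℝ^n` with shift pattern `t`, indexed by generation and
position. -/
def gridCube (t : Fin n → Bool) (e : ℤ × (Fin n → ℤ)) : Cube n where
  corner i := 2 ^ e.1 * (e.2 i + gridShift (t i) e.1)
  side := 2 ^ e.1
  side_pos := by positivity

theorem mem_gridCube {t : Fin n → Bool} {e : ℤ × (Fin n → ℤ)} {x : Rn n} :
    x ∈ (gridCube t e).set ↔ ∀ i, gridIndex (t i) e.1 (x i) = e.2 i := by
  have h2 : (0 : ℝ) < 2 ^ e.1 := by positivity
  refine forall_congr' fun i => ?_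
  rw [gridIndex, Int.floor_eq_iff, le_sub_iff_add_le, le_div_iff₀ h2, sub_lt_iff_lt_add,
    div_lt_iff₀ h2]
  simp only [gridCube]
  constructor <;> rintro ⟨h, h'⟩ <;> constructor <;> linarith

theorem gridCube_nested (t : Fin n → Bool) (e e' : ℤ × (Fin n → ℤ)) (h : e.1 ≤ e'.1) :
    (gridCube t e).set ⊆ (gridCube t e').set ∨
      Disjoint (gridCube t e).set (gridCube t e').set := by
  by_cases hd : Disjoint (gridCube t e).set (gridCube t e').set
  · exact Or.inr hd
  obtain ⟨x, hx, hx'⟩ := Set.not_disjoint_iff.1 hd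
  refine Or.inl fun y hy => ?_
  rw [mem_gridCube] at hx hx' hy ⊢
  exact fun i => (gridIndex_eq_of_le h ((hy i).trans (hx i).symm)).trans (hx' i)

open Classical in
theorem isLaminar_gridCube (t : Fin n → Bool) (F : Finset (ℤ × (Fin n → ℤ))) :
    IsLaminar (F.image fun e => (gridCube t e).set) := by
  intro P hP Q hQ
  obtain ⟨e, -, rfl⟩ := Finset.mem_image.1 hP
  obtain ⟨e', -, rfl⟩ := Finset.mem_image.1 hQ
  rcases le_total e.1 e'.1 with h | h
  · rcases gridCube_nested t e e' h with h | h
    · exact Or.inl h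
    · exact Or.inr (Or.inr h)
  · rcases gridCube_nested t e' e h with h | h
    · exact Or.inr (Or.inl h)
    · exact Or.inr (Or.inr h.symm)

/-- Every cube lies in a cube of comparable size from one of the shifted dyadic grids. -/
theorem Cube.exists_subset_gridCube (Q : Cube n) :
    ∃ t e, Q.set ⊆ (gridCube t e).set ∧ (gridCube t e).side ≤ 6 * Q.side := by
  obtain ⟨k, hk, hk'⟩ := exists_mem_Ioc_zpow (x := 3 * Q.side) (y := (2 : ℝ))
    (by linarith [Q.side_pos]) (by norm_num)
  choose t ht using fun i => exists_gridIndex_const (a := Q.corner i) hk'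
  refine ⟨t, (k + 1, fun i => gridIndex (t i) (k + 1) (Q.corner i)), fun x hx => ?_, ?_⟩
  · exact mem_gridCube.2 fun i => ht i (x i) (hx i).1 (hx i).2
  · simp only [gridCube]
    rw [zpow_add_one₀ two_ne_zero]
    linarith

theorem Cube.set_eq_pi (Q : Cube n) :
    Q.set = univ.pi fun i => Ico (Q.corner i) (Q.corner i + Q.side) := by
  ext x
  simp [Cube.set]

theorem Cube.measurableSet (Q : Cube n) : MeasurableSet Q.set := by
  rw [Q.set_eq_pi]
  exact MeasurableSet.univ_pi fun _ => measurableSet_Ico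

theorem Cube.vol_pos (Q : Cube n) : 0 < Q.vol := pow_pos Q.side_pos n

theorem Cube.volume_set (Q : Cube n) : volume Q.set = ENNReal.ofReal Q.vol := by
  rw [Q.set_eq_pi, Real.volume_pi_Ico]
  simp [Cube.vol, ENNReal.ofReal_pow Q.side_pos.le]

theorem Cube.ofReal_vol_rpow (Q : Cube n) (γ : ℝ) :
    ENNReal.ofReal (Q.vol ^ γ) = volume Q.set ^ γ := by
  rw [Q.volume_set, ENNReal.ofReal_rpow_of_pos Q.vol_pos]

theorem Cube.volume_ne_zero (Q : Cube n) : volume Q.set ≠ 0 := by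
  simp [Q.volume_set, Q.vol_pos]

theorem Cube.volume_ne_top (Q : Cube n) : volume Q.set ≠ ∞ := by
  simp [Q.volume_set]

theorem IsWeight.setLIntegral_ne_top {w : Rn n → ℝ} (hw : IsWeight w) (Q : Cube n) :
    ∫⁻ x in Q.set, ENNReal.ofReal (w x) ≠ ∞ := by
  have hsub : Q.set ⊆ Icc Q.corner (fun i => Q.corner i + Q.side) := fun x hx =>
    ⟨fun i => (hx i).1, fun i => (hx i).2.le⟩
  have hi : IntegrableOn w Q.set :=
    (hw.2.2.integrableOn_isCompact isCompact_Icc).mono_set hsub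
  exact hi.lintegral_lt_top.ne

/-- The maximal operator over all cubes is controlled by those over the shifted grids. -/
theorem fracMax_le_iSup_gridCube {α : ℝ} (hn : 0 < n) (hαn : α < n) (g : Rn n → ℝ≥0∞) (x : Rn n) :
    fracMax α g x ≤ ((6 : ℝ≥0∞) ^ n) ^ (1 - α / n) * ⨆ t : Fin n → Bool, ⨆ e,
      (gridCube t e).set.indicator
        (fun _ => volume (gridCube t e).set ^ (α / n - 1) * ∫⁻ y in (gridCube t e).set, g y) x := by
  refine iSup₂_le fun Q hQ => ?_
  obtain ⟨t, e, hsub, hside⟩ := Q.exists_subset_gridCube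
  set P := gridCube t e with hP
  have hα : 0 < 1 - α / n := by
    rw [sub_pos, div_lt_one (by exact_mod_cast hn)]
    exact hαn
  have hvol : volume P.set ≤ 6 ^ n * volume Q.set := by
    rw [P.volume_set, Q.volume_set, Cube.vol, Cube.vol]
    calc ENNReal.ofReal (P.side ^ n) ≤ ENNReal.ofReal ((6 * Q.side) ^ n) := by
          gcongr
          exact P.side_pos.le
      _ = _ := by
          rw [mul_pow, ENNReal.ofReal_mul (by positivity)]
          norm_num
  have hpow : volume Q.set ^ (α / n - 1) ≤
      ((6 : ℝ≥0∞) ^ n) ^ (1 - α / n) * volume P.set ^ (α / n - 1) := by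
    have h := ENNReal.rpow_le_rpow hvol hα.le
    rw [ENNReal.mul_rpow_of_nonneg _ _ hα.le] at h
    have e1 : ∀ R : Cube n, volume R.set ^ (α / n - 1) = (volume R.set ^ (1 - α / n))⁻¹ := fun R => by
      rw [← ENNReal.rpow_neg, neg_sub]
    have hnz : ∀ R : Cube n, volume R.set ^ (1 - α / n) ≠ 0 := fun R =>
      (ENNReal.rpow_pos (pos_iff_ne_zero.2 R.volume_ne_zero) R.volume_ne_top).ne'
    have hnt : ∀ R : Cube n, volume R.set ^ (1 - α / n) ≠ ∞ := fun R =>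
      ENNReal.rpow_ne_top_of_nonneg hα.le R.volume_ne_top
    rw [e1, e1, ← div_eq_mul_inv, ENNReal.le_div_iff_mul_le (Or.inl (hnz P)) (Or.inl (hnt P)),
      mul_comm, ← div_eq_mul_inv]
    exact ENNReal.div_le_of_le_mul h
  rw [Q.ofReal_vol_rpow]
  calc volume Q.set ^ (α / n - 1) * ∫⁻ y in Q.set, g y
      ≤ ((6 : ℝ≥0∞) ^ n) ^ (1 - α / n) * volume P.set ^ (α / n - 1) * ∫⁻ y in P.set, g y := by
        gcongr
    _ = ((6 : ℝ≥0∞) ^ n) ^ (1 - α / n) * (volume P.set ^ (α / n - 1) * ∫⁻ y in P.set, g y) :=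
        mul_assoc _ _ _
    _ ≤ _ := by
        gcongr
        refine le_iSup₂_of_le t e ?_
        rw [indicator_of_mem (hsub hQ)]

end Grid

section Assembly

variable {n : ℕ}

theorem one_div_conjExp {p : ℝ} (hp : 1 < p) : 1 / conjExp p = 1 - 1 / p := by
  have : p - 1 ≠ 0 := by linarith
  rw [conjExp, one_div_div]
  field_simp

theorem le_Apq {α p q : ℝ} (hp : 1 < p) (hq : 0 < q) (u σ : Rn n → ℝ) (Q : Cube n) :
    volume Q.set ^ (α / n - 1) * (∫⁻ x in Q.set, ENNReal.ofReal (u x)) ^ (1 / q) *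
      (∫⁻ x in Q.set, ENNReal.ofReal (σ x)) ^ (1 - 1 / p) ≤ Apq α p q u σ := by
  refine le_trans (le_of_eq ?_) (le_iSup (fun Q => ApqQ α p q u σ Q) Q)
  have h1p : 0 ≤ 1 - 1 / p := by
    rw [sub_nonneg, div_le_one (by linarith)]
    exact hp.le
  rw [ApqQ, one_div_conjExp hp, Q.ofReal_vol_rpow, avgW, avgW, avgE, avgE, ← Q.volume_set,
    ENNReal.div_rpow_of_nonneg _ _ (by positivity), ENNReal.div_rpow_of_nonneg _ _ h1p,
    div_eq_mul_inv (_ : ℝ≥0∞), div_eq_mul_inv (_ : ℝ≥0∞), ← ENNReal.rpow_neg, ← ENNReal.rpow_neg,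
    show α / n - 1 = (α / n + 1 / q - 1 / p) + -(1 / q) + -(1 - 1 / p) by ring,
    ENNReal.rpow_add _ _ Q.volume_ne_zero Q.volume_ne_top,
    ENNReal.rpow_add _ _ Q.volume_ne_zero Q.volume_ne_top]
  ring

theorem setLIntegral_fracMax_le_FW {σ : Rn n → ℝ} (hσ : IsWeight σ) (R : Cube n)
    (h0 : ∫⁻ x in R.set, ENNReal.ofReal (σ x) ≠ 0) :
    ∫⁻ x in R.set, fracMax 0 (R.set.indicator fun y => ENNReal.ofReal (σ y)) x ≤
      FW σ * ∫⁻ x in R.set, ENNReal.ofReal (σ x) :=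
  (ENNReal.div_le_iff h0 (hσ.setLIntegral_ne_top R)).1 (le_iSup (fun Q => FWQ Q σ) R)

theorem average_indicator_le_fracMax (σ : Rn n → ℝ) {Q R : Cube n} (hQR : Q.set ⊆ R.set)
    (x : Rn n) :
    Q.set.indicator (fun _ => (∫⁻ y in Q.set, ENNReal.ofReal (σ y)) / volume Q.set) x ≤
      fracMax 0 (R.set.indicator fun y => ENNReal.ofReal (σ y)) x := by
  by_cases hx : x ∈ Q.set
  swap
  · simp [hx]
  rw [indicator_of_mem hx]
  refine le_trans (le_of_eq ?_) (le_iSup₂_of_le Q hx le_rfl)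
  rw [Q.ofReal_vol_rpow, zero_div, zero_sub, ENNReal.rpow_neg_one, div_eq_mul_inv, mul_comm]
  congr 1
  refine setLIntegral_congr_fun Q.measurableSet fun y hy => ?_
  rw [indicator_of_mem (hQR hy)]

/-- The two-weight bound for the maximal operator over a single shifted dyadic grid. -/
theorem exists_lintegral_gridCube_max_le {p q α : ℝ} (hα : 0 < α) (hp : 1 < p) (hpq : p ≤ q) :
    ∃ C : ℝ≥0∞, C ≠ ∞ ∧ ∀ (u σ : Rn n → ℝ), IsWeight u → IsWeight σ →
      ∀ f : Rn n → ℝ≥0∞, Measurable f → ∫⁻ x, f x ^ p * ENNReal.ofReal (σ x) ≠ ∞ →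
      ∀ t : Fin n → Bool,
      ∫⁻ x, (⨆ e, (gridCube t e).set.indicator (fun _ => volume (gridCube t e).set ^ (α / n - 1) *
          ∫⁻ y in (gridCube t e).set, mulW f σ y) x) ^ q * ENNReal.ofReal (u x) ≤
        C * Apq α p q u σ ^ q * FW σ * (∫⁻ x, f x ^ p * ENNReal.ofReal (σ x)) ^ (q / p) := by
  classical
  obtain ⟨C, hC, hcore⟩ := exists_lintegral_laminar_max_le hp hpq
  have hq0 : 0 < q := by linarith
  refine ⟨C, hC, fun u σ hu hσ f hf hN t => ?_⟩
  have hum : Measurable fun x => ENNReal.ofReal (u x) := hu.1.ennreal_ofReal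
  have hσm : Measurable fun x => ENNReal.ofReal (σ x) := hσ.1.ennreal_ofReal
  set U := (volume : Measure (Rn n)).withDensity fun x => ENNReal.ofReal (u x) with hU
  set W := (volume : Measure (Rn n)).withDensity fun x => ENNReal.ofReal (σ x) with hW
  have hUQ : ∀ Q : Cube n, U Q.set = ∫⁻ x in Q.set, ENNReal.ofReal (u x) := fun Q =>
    withDensity_apply _ Q.measurableSet
  have hWQ : ∀ Q : Cube n, W Q.set = ∫⁻ x in Q.set, ENNReal.ofReal (σ x) := fun Q =>
    withDensity_apply _ Q.measurableSet
  have hfW : ∀ Q : Cube n, ∫⁻ y in Q.set, mulW f σ y = ∫⁻ y in Q.set, f y ∂W := fun Q => by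
    rw [setLIntegral_withDensity_eq_setLIntegral_mul _ hσm hf Q.measurableSet]
    simp [mulW, mul_comm]
  have hNW : ∫⁻ x, f x ^ p * ENNReal.ofReal (σ x) = ∫⁻ x, f x ^ p ∂W := by
    rw [lintegral_withDensity_eq_lintegral_mul _ hσm (hf.pow_const p)]
    simp [mul_comm]
  set B : ℤ × (Fin n → ℤ) → Set (Rn n) := fun e => (gridCube t e).set with hB
  have hBm : ∀ e, MeasurableSet (B e) := fun e => (gridCube t e).measurableSet
  set h : ℤ × (Fin n → ℤ) → Rn n → ℝ≥0∞ := fun e =>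
    (B e).indicator (fun _ => volume (B e) ^ (α / n - 1) * ∫⁻ y in B e, f y ∂W) with hh
  have hhm : ∀ e, Measurable (h e) := fun e => measurable_const.indicator (hBm e)
  have hFm : ∀ F : Finset (ℤ × (Fin n → ℤ)), Measurable fun x => (⨆ e ∈ F, h e x) ^ q := fun F =>
    (Measurable.biSup _ F.countable_toSet fun e _ => hhm e).pow_const q
  calc ∫⁻ x, (⨆ e, (B e).indicator (fun _ => volume (B e) ^ (α / n - 1) *
          ∫⁻ y in B e, mulW f σ y) x) ^ q * ENNReal.ofReal (u x)
      = ∫⁻ x, (⨆ e, h e x) ^ q ∂U := by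
        rw [lintegral_withDensity_eq_lintegral_mul _ hum ((Measurable.iSup hhm).pow_const q)]
        refine lintegral_congr fun x => ?_
        simp only [hh, hB, hfW, Pi.mul_apply]
        rw [mul_comm]
    _ = ∫⁻ x, ⨆ F : Finset (ℤ × (Fin n → ℤ)), (⨆ e ∈ F, h e x) ^ q ∂U := by
        refine lintegral_congr fun x => ?_
        rw [iSup_eq_iSup_finset]
        exact (ENNReal.orderIsoRpow q hq0).map_iSup _
    _ = ⨆ F : Finset (ℤ × (Fin n → ℤ)), ∫⁻ x, (⨆ e ∈ F, h e x) ^ q ∂U := by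
        refine lintegral_iSup_directed (fun F => (hFm F).aemeasurable) ?_
        refine Monotone.directed_le fun F G hFG x => ?_
        exact ENNReal.rpow_le_rpow (biSup_mono fun e he => hFG he) hq0.le
    _ ≤ _ := by
        refine iSup_le fun F => ?_
        have hrange : ∀ Q ∈ F.image B, ∃ e, B e = Q := fun Q hQ => by
          obtain ⟨e, -, he⟩ := Finset.mem_image.1 hQ
          exact ⟨e, he⟩
        have hmain := hcore volume U W (F.image B) (α / n - 1) (Apq α p q u σ) (FW σ) f
          (by linarith [show 0 ≤ α / n by positivity]) hf (isLaminar_gridCube t F) ?_ ?_ ?_ ?_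
          (hNW ▸ hN) ?_ ?_
        · rw [hNW]
          refine le_trans (lintegral_mono fun x => ENNReal.rpow_le_rpow ?_ hq0.le) hmain
          exact iSup₂_le fun e he => le_iSup₂_of_le (B e) (Finset.mem_image_of_mem B he) le_rfl
        · intro Q hQ
          obtain ⟨e, rfl⟩ := hrange Q hQ
          exact hBm e
        · intro Q hQ
          obtain ⟨e, rfl⟩ := hrange Q hQ
          exact (gridCube t e).volume_ne_zero
        · intro Q hQ
          obtain ⟨e, rfl⟩ := hrange Q hQ
          exact (gridCube t e).volume_ne_top
        · intro Q hQ
          obtain ⟨e, rfl⟩ := hrange Q hQ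
          rw [hWQ]
          exact hσ.setLIntegral_ne_top _
        · intro Q hQ
          obtain ⟨e, rfl⟩ := hrange Q hQ
          rw [hWQ, hUQ]
          exact le_Apq hp hq0 u σ _
        · intro R hR
          obtain ⟨e, rfl⟩ := hrange R hR
          by_cases h0 : W (B e) = 0
          · refine le_of_eq_of_le ?_ zero_le
            rw [← lintegral_zero (μ := volume.restrict (B e))]
            refine lintegral_congr fun x => ?_
            simp only [iSup_eq_zero]
            intro Q _ hQR
            simp [measure_mono_null hQR h0]
          · rw [hWQ] at h0 ⊢
            refine le_trans (lintegral_mono fun x => ?_) (setLIntegral_fracMax_le_FW hσ _ h0)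
            refine iSup₂_le fun Q hQ => iSup_le fun hQR => ?_
            obtain ⟨e', rfl⟩ := hrange Q hQ
            rw [hWQ]
            exact average_indicator_le_fracMax σ hQR x

theorem measurable_iSup_gridCube_indicator (t : Fin n → Bool) (c : ℤ × (Fin n → ℤ) → ℝ≥0∞) :
    Measurable fun x => ⨆ e, (gridCube t e).set.indicator (fun _ => c e) x :=
  Measurable.iSup fun e => measurable_const.indicator (gridCube t e).measurableSet

/-- The two-weight bound for the fractional maximal operator, with `q`-th powers. -/
theorem exists_lintegral_fracMax_le {p q α : ℝ} (hn : 0 < n) (hα : 0 < α) (hαn : α < n)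
    (hp : 1 < p) (hpq : p ≤ q) :
    ∃ C : ℝ≥0∞, C ≠ ∞ ∧ ∀ (u σ : Rn n → ℝ), IsWeight u → IsWeight σ →
      ∀ f : Rn n → ℝ≥0∞, Measurable f → ∫⁻ x, f x ^ p * ENNReal.ofReal (σ x) ≠ ∞ →
      ∫⁻ x, fracMax α (mulW f σ) x ^ q * ENNReal.ofReal (u x) ≤
        C * Apq α p q u σ ^ q * FW σ * (∫⁻ x, f x ^ p * ENNReal.ofReal (σ x)) ^ (q / p) := by
  obtain ⟨C, hC, hgrid⟩ := exists_lintegral_gridCube_max_le (n := n) hα hp hpq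
  have hq0 : 0 < q := by linarith
  set c := ((6 : ℝ≥0∞) ^ n) ^ (1 - α / n) with hc
  have hα1 : 0 ≤ 1 - α / n := by
    rw [sub_nonneg, div_le_one (by exact_mod_cast hn)]
    exact hαn.le
  have hct : c ≠ ∞ := ENNReal.rpow_ne_top_of_nonneg hα1 (by simp)
  have hcqt : c ^ q ≠ ∞ := ENNReal.rpow_ne_top_of_nonneg hq0.le hct
  refine ⟨c ^ q * (Fintype.card (Fin n → Bool) * C),
    ENNReal.mul_ne_top hcqt (ENNReal.mul_ne_top (by simp) hC), fun u σ hu hσ f hf hN => ?_⟩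
  set N := ∫⁻ x, f x ^ p * ENNReal.ofReal (σ x) with hNdef
  set G : (Fin n → Bool) → Rn n → ℝ≥0∞ := fun t x => ⨆ e, (gridCube t e).set.indicator
    (fun _ => volume (gridCube t e).set ^ (α / n - 1) *
      ∫⁻ y in (gridCube t e).set, mulW f σ y) x with hG
  have hGm : ∀ t, Measurable (G t) := fun t => measurable_iSup_gridCube_indicator t _
  calc ∫⁻ x, fracMax α (mulW f σ) x ^ q * ENNReal.ofReal (u x)
      ≤ ∫⁻ x, c ^ q * ∑ t, G t x ^ q * ENNReal.ofReal (u x) := by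
        refine lintegral_mono fun x => ?_
        rw [← Finset.sum_mul, ← mul_assoc]
        refine mul_le_mul' ?_ le_rfl
        refine (ENNReal.rpow_le_rpow (fracMax_le_iSup_gridCube hn hαn _ x) hq0.le).trans ?_
        rw [ENNReal.mul_rpow_of_nonneg _ _ hq0.le]
        gcongr
        refine ((ENNReal.orderIsoRpow q hq0).map_iSup _).trans_le (iSup_le fun t => ?_)
        exact Finset.single_le_sum (f := fun t => G t x ^ q) (fun _ _ => zero_le)
          (Finset.mem_univ t)
    _ = c ^ q * ∑ t, ∫⁻ x, G t x ^ q * ENNReal.ofReal (u x) := by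
        rw [lintegral_const_mul' _ _ hcqt, lintegral_finsetSum]
        exact fun t _ => ((hGm t).pow_const q).mul hu.1.ennreal_ofReal
    _ ≤ c ^ q * ∑ _t : Fin n → Bool, C * Apq α p q u σ ^ q * FW σ * N ^ (q / p) := by
        refine mul_le_mul' le_rfl (Finset.sum_le_sum fun t _ => ?_)
        exact hgrid u σ hu hσ f hf hN t
    _ = _ := by
        rw [Finset.sum_const, nsmul_eq_mul, Finset.card_univ]
        ring

end Assembly

/-- two-suprema bound for the fractional maximal operator:
if `(u,σ) ∈ A^α_{p,q}` and `σ ∈ A_∞`, then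
`‖M_α(·σ)‖_{L^p(σ)→L^q(u)} ≤ C [u,σ]_{A^α_{p,q}} [σ]_{A^M_∞}^{1/q}`. -/
theorem stmt3 (n : ℕ) (hn : 0 < n) (α p q : ℝ) (hα : 0 < α) (hαn : α < n)
    (hp : 1 < p) (hpq : p ≤ q) :
    ∃ C : ℝ≥0∞, 0 < C ∧ C < ∞ ∧
      ∀ u σ : Rn n → ℝ, IsWeight u → IsWeight σ → Apq α p q u σ < ∞ → IsAinf σ →
        opNormStrong (fracMax α) p q σ u ≤
          C * Apq α p q u σ * FW σ ^ (1 / q) := by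
  obtain ⟨C, hC, h⟩ := exists_lintegral_fracMax_le hn hα hαn hp hpq
  have hp0 : 0 < p := by linarith
  have hq0 : 0 < q := by linarith
  have hq1 : 0 ≤ 1 / q := by positivity
  refine ⟨C ^ (1 / q) + 1, by simp, ?_, fun u σ hu hσ _ _ => ?_⟩
  · exact ENNReal.add_lt_top.2
      ⟨(ENNReal.rpow_ne_top_of_nonneg hq1 hC).lt_top, ENNReal.one_lt_top⟩
  refine iSup₂_le fun f hf => ?_
  by_cases hN : ∫⁻ x, f x ^ p * ENNReal.ofReal (σ x) = ∞
  · have hL : LpW f p σ = ∞ := by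
      rw [LpW, hN, ENNReal.top_rpow_of_pos (by positivity)]
    rw [hL, ENNReal.div_top]
    exact zero_le
  refine ENNReal.div_le_of_le_mul ?_
  calc LpW (fracMax α (mulW f σ)) q u
      ≤ (C * Apq α p q u σ ^ q * FW σ *
          (∫⁻ x, f x ^ p * ENNReal.ofReal (σ x)) ^ (q / p)) ^ (1 / q) :=
        ENNReal.rpow_le_rpow (h u σ hu hσ f hf hN) hq1
    _ = C ^ (1 / q) * Apq α p q u σ * FW σ ^ (1 / q) * LpW f p σ := by
        rw [ENNReal.mul_rpow_of_nonneg _ _ hq1, ENNReal.mul_rpow_of_nonneg _ _ hq1,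
          ENNReal.mul_rpow_of_nonneg _ _ hq1, ← ENNReal.rpow_mul, ← ENNReal.rpow_mul,
          mul_one_div_cancel hq0.ne', ENNReal.rpow_one, LpW]
        congr 2
        field_simp
    _ ≤ (C ^ (1 / q) + 1) * Apq α p q u σ * FW σ ^ (1 / q) * LpW f p σ := by
        gcongr
        exact le_self_add
end
end

section
/- For every 0<α<n and 1<p≤q<∞ there exist a pair of weights (u,σ) on ℝ^n with [u,σ]_{A^α_{p,q}}<∞ and a nonnegative function f∈L^p(σ) such that M_α(fσ)∉L^q(u), i.e., ∫_{ℝ^n} M_α(fσ)^q u dx = ∞. -/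
open MeasureTheory ENNReal Set

noncomputable section

/-- The `r^{s-n}` mass of a ball of radius `R` is `O(R^s)`. -/
lemma exists_lintegral_ball_norm_rpow_le {n : ℕ} (hn : 0 < n) {s : ℝ} (hs : 0 < s) :
    ∃ C : ℝ, 0 < C ∧ ∀ R : ℝ, 0 < R →
      ∫⁻ x in Metric.ball (0 : Rn n) R, ENNReal.ofReal (‖x‖ ^ (s - n)) ≤
        ENNReal.ofReal (C * R ^ s) := by
  have : Nonempty (Fin n) := ⟨⟨0, hn⟩⟩
  have hmul : ∀ y : ℝ, 0 < y → y ^ (n - 1) • y ^ (s - n) = y ^ (s - 1) := by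
    intro y hy
    rw [smul_eq_mul, ← Real.rpow_natCast, ← Real.rpow_add hy, Nat.cast_sub hn]
    congr 1
    push_cast
    ring
  have hint : ∀ R : ℝ, 0 < R → IntegrableOn (fun y : ℝ => y ^ (s - 1)) (Ioo 0 R) := by
    intro R hR
    have h := intervalIntegral.intervalIntegrable_rpow' (a := 0) (b := R) (r := s - 1) (by linarith)
    rw [intervalIntegrable_iff_integrableOn_Ioo_of_le hR.le] at h
    exact h
  refine ⟨n * volume.real (Metric.ball (0 : Rn n) 1) / s + 1, by positivity, fun R hR => ?_⟩
  have hi : IntegrableOn (fun x : Rn n => ‖x‖ ^ (s - n)) (Metric.ball 0 R) := by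
    rw [integrableOn_fun_norm_addHaar volume (f := fun y : ℝ => y ^ (s - n))]
    refine (hint R hR).congr_fun ?_ measurableSet_Ioo
    intro y hy
    simp only [Module.finrank_fin_fun]
    exact (hmul y hy.1).symm
  rw [← ofReal_integral_eq_lintegral_ofReal hi (ae_of_all _ fun x => by positivity)]
  apply ENNReal.ofReal_le_ofReal
  have h1 : ∫ x in Metric.ball (0 : Rn n) R, ‖x‖ ^ (s - n) =
      ∫ x : Rn n, (Iio R).indicator (fun y : ℝ => y ^ (s - n)) ‖x‖ := by
    rw [← integral_indicator measurableSet_ball]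
    refine integral_congr_ae (ae_of_all _ fun x => ?_)
    simp [indicator]
  have h2 : ∫ y in Ioi (0 : ℝ), y ^ (n - 1) • (Iio R).indicator (fun y : ℝ => y ^ (s - n)) y =
      R ^ s / s := by
    have h3 : ∀ y ∈ Ioi (0 : ℝ), y ^ (n - 1) • (Iio R).indicator (fun y : ℝ => y ^ (s - n)) y =
        (Iio R).indicator (fun y : ℝ => y ^ (s - 1)) y := by
      intro y hy
      by_cases h : y < R
      · simpa [indicator, h] using hmul y hy
      · simp [indicator, h]
    rw [setIntegral_congr_fun measurableSet_Ioi h3, setIntegral_indicator measurableSet_Iio,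
      Ioi_inter_Iio, ← integral_Ioc_eq_integral_Ioo, ← intervalIntegral.integral_of_le hR.le,
      integral_rpow (Or.inl (by linarith))]
    simp [Real.zero_rpow hs.ne']
  rw [h1, integral_fun_norm_addHaar, Module.finrank_fin_fun, h2, nsmul_eq_mul, smul_eq_mul]
  have : 0 < R ^ s := by positivity
  calc _ = n * volume.real (Metric.ball (0 : Rn n) 1) / s * R ^ s := by ring
    _ ≤ _ := by gcongr; linarith

/-- `r^{-n}` has infinite mass at infinity. -/
lemma lintegral_norm_rpow_neg_compl_ball {n : ℕ} (hn : 0 < n) :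
    ∫⁻ x in {x : Rn n | 2 ≤ ‖x‖}, ENNReal.ofReal (‖x‖ ^ (-n : ℝ)) = ∞ := by
  have : Nonempty (Fin n) := ⟨⟨0, hn⟩⟩
  have hms : MeasurableSet {x : Rn n | 2 ≤ ‖x‖} := measurableSet_le measurable_const measurable_norm
  by_contra hne
  have hi : IntegrableOn (fun x : Rn n => ‖x‖ ^ (-n : ℝ)) {x | 2 ≤ ‖x‖} := by
    refine ⟨(measurable_norm.pow_const _).aestronglyMeasurable, ?_⟩
    rw [hasFiniteIntegral_iff_ofReal (ae_of_all _ fun x => by positivity)]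
    exact lt_top_iff_ne_top.2 hne
  rw [← integrable_indicator_iff hms] at hi
  have hi' : Integrable fun x : Rn n => (Ici 2).indicator (fun y : ℝ => y ^ (-n : ℝ)) ‖x‖ := by
    refine hi.congr (ae_of_all _ fun x => ?_)
    simp [indicator]
  rw [integrable_fun_norm_addHaar] at hi'
  refine not_integrableOn_Ioi_inv (a := 2)
    ((hi'.mono_set (Ioi_subset_Ioi zero_le_two)).congr_fun ?_ measurableSet_Ioi)
  intro y hy
  have hy2 : (2 : ℝ) < y := hy
  have hy0 : 0 < y := by linarith
  simp only [Module.finrank_fin_fun, smul_eq_mul]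
  rw [indicator_of_mem (show y ∈ Ici (2 : ℝ) from hy2.le), ← Real.rpow_natCast,
    ← Real.rpow_add hy0, ← Real.rpow_neg_one, Nat.cast_sub hn]
  congr 1
  push_cast
  ring

lemma Cube.measurableSet_set {n : ℕ} (Q : Cube n) : MeasurableSet Q.set := by
  have : Q.set = ⋂ i, {x : Rn n | Q.corner i ≤ x i ∧ x i < Q.corner i + Q.side} := by
    ext; simp [Cube.set]
  rw [this]
  exact MeasurableSet.iInter fun i =>
    (measurableSet_le measurable_const (measurable_pi_apply i)).inter
      (measurableSet_lt (measurable_pi_apply i) measurable_const)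

lemma Cube.norm_sub_le {n : ℕ} (Q : Cube n) {x y : Rn n} (hx : x ∈ Q.set) (hy : y ∈ Q.set) :
    ‖x - y‖ ≤ Q.side := by
  rw [pi_norm_le_iff_of_nonneg Q.side_pos.le]
  intro i
  have := hx i
  have := hy i
  rw [Pi.sub_apply, Real.norm_eq_abs, abs_le]
  constructor <;> linarith

/-- Power weight `|x|^{s-n}` restricted to `|x| ≥ 2`. -/
def tailWeight (n : ℕ) (s : ℝ) : Rn n → ℝ :=
  {x : Rn n | 2 ≤ ‖x‖}.indicator fun x => ‖x‖ ^ (s - n)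

/-- Indicator function of the unit ball. -/
def ballWeight (n : ℕ) : Rn n → ℝ := (Metric.ball (0 : Rn n) 1).indicator fun _ => 1

lemma measurableSet_two_le_norm (n : ℕ) : MeasurableSet {x : Rn n | 2 ≤ ‖x‖} :=
  measurableSet_le measurable_const measurable_norm

lemma tailWeight_nonneg (n : ℕ) (s : ℝ) (x : Rn n) : 0 ≤ tailWeight n s x :=
  indicator_nonneg (fun _ _ => by positivity) x

lemma tailWeight_le (n : ℕ) (s : ℝ) (x : Rn n) : tailWeight n s x ≤ ‖x‖ ^ (s - n) :=
  indicator_le_self' (fun _ _ => by positivity) x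

lemma isWeight_tailWeight {n : ℕ} (hn : 0 < n) {s : ℝ} (hs : 0 < s) :
    IsWeight (tailWeight n s) := by
  have hm : Measurable (tailWeight n s) :=
    Measurable.indicator (by fun_prop) (measurableSet_two_le_norm n)
  refine ⟨hm, tailWeight_nonneg n s, ?_⟩
  refine locallyIntegrable_of_norm_le_rpow (C := 1) (α := n - s) (by simpa using Nat.succ_le_of_lt hn)
    (by simpa using hs) (ae_of_all _ fun x => ?_) hm.aestronglyMeasurable
  rw [Real.norm_of_nonneg (tailWeight_nonneg n s x), one_mul, neg_sub]
  exact tailWeight_le n s x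

lemma isWeight_ballWeight (n : ℕ) : IsWeight (ballWeight n) := by
  refine ⟨measurable_const.indicator measurableSet_ball,
    fun x => indicator_nonneg (fun _ _ => zero_le_one) x, ?_⟩
  exact (locallyIntegrable_const (1 : ℝ)).indicator measurableSet_ball

lemma ofReal_ballWeight (n : ℕ) (x : Rn n) :
    ENNReal.ofReal (ballWeight n x) = (Metric.ball (0 : Rn n) 1).indicator 1 x := by
  by_cases h : x ∈ Metric.ball (0 : Rn n) 1 <;> simp [ballWeight, h]

lemma lintegral_ballWeight (n : ℕ) :
    ∫⁻ x, ENNReal.ofReal (ballWeight n x) = volume (Metric.ball (0 : Rn n) 1) := by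
  simp_rw [ofReal_ballWeight]
  exact lintegral_indicator_one measurableSet_ball

lemma apqQ_tailWeight_ballWeight_le {n : ℕ} (hn : 0 < n) {α p q C : ℝ} (hp : 1 < p) (hq : 0 < q)
    (hC0 : 0 < C)
    (hC : ∀ R : ℝ, 0 < R →
      ∫⁻ x in Metric.ball (0 : Rn n) R, ENNReal.ofReal (‖x‖ ^ ((n - α) * q - n)) ≤
        ENNReal.ofReal (C * R ^ ((n - α) * q))) (Q : Cube n) :
    ApqQ α p q (tailWeight n ((n - α) * q)) (ballWeight n) Q ≤
      ENNReal.ofReal ((C * 3 ^ ((n - α) * q)) ^ (1 / q) *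
        volume.real (Metric.ball (0 : Rn n) 1) ^ (1 / conjExp p)) := by
  have hL := Q.side_pos
  have hV : 0 < Q.vol := by unfold Cube.vol; positivity
  have hp' : 0 < 1 / conjExp p := by
    unfold conjExp
    have : 0 < p - 1 := by linarith
    positivity
  have hq' : 0 < 1 / q := by positivity
  by_cases hx : ∃ x ∈ Q.set, ‖x‖ < 1
  swap
  · have h0 : avgW Q (ballWeight n) = 0 := by
      have : ∫⁻ x in Q.set, ENNReal.ofReal (ballWeight n x) = 0 := by
        rw [setLIntegral_congr_fun Q.measurableSet_set (g := fun _ => 0), lintegral_zero]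
        intro x hxQ
        have : x ∉ Metric.ball (0 : Rn n) 1 := fun h => hx ⟨x, hxQ, by simpa using h⟩
        simp [ballWeight, this]
      simp [avgW, avgE, this]
    rw [ApqQ, h0, ENNReal.zero_rpow_of_pos hp', mul_zero]
    exact zero_le
  by_cases hy : ∃ y ∈ Q.set, 2 ≤ ‖y‖
  swap
  · have h0 : avgW Q (tailWeight n ((n - α) * q)) = 0 := by
      have : ∫⁻ x in Q.set, ENNReal.ofReal (tailWeight n ((n - α) * q) x) = 0 := by
        rw [setLIntegral_congr_fun Q.measurableSet_set (g := fun _ => 0), lintegral_zero]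
        intro x hxQ
        have : x ∉ {x : Rn n | 2 ≤ ‖x‖} := fun h => hy ⟨x, hxQ, h⟩
        simp only [tailWeight, indicator_of_notMem this, ENNReal.ofReal_zero]
      simp [avgW, avgE, this]
    rw [ApqQ, h0, ENNReal.zero_rpow_of_pos hq', mul_zero, zero_mul]
    exact zero_le
  obtain ⟨x, hxQ, hx1⟩ := hx
  obtain ⟨y, hyQ, hy2⟩ := hy
  have hside : 1 < Q.side := by
    have h1 := Q.norm_sub_le hyQ hxQ
    have h2 := norm_sub_norm_le y x
    linarith
  have hsub : Q.set ⊆ Metric.ball (0 : Rn n) (3 * Q.side) := by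
    intro z hz
    have h1 := Q.norm_sub_le hz hxQ
    have h2 := norm_sub_norm_le z x
    rw [mem_ball_zero_iff]
    linarith
  have hu : avgW Q (tailWeight n ((n - α) * q)) ≤
      ENNReal.ofReal (C * (3 * Q.side) ^ ((n - α) * q) / Q.vol) := by
    rw [ENNReal.ofReal_div_of_pos hV]
    refine ENNReal.div_le_div_right ?_ _
    calc _ ≤ ∫⁻ x in Q.set, ENNReal.ofReal (‖x‖ ^ ((n - α) * q - n)) :=
          lintegral_mono fun x => ENNReal.ofReal_le_ofReal (tailWeight_le n _ x)
      _ ≤ _ := lintegral_mono_set hsub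
      _ ≤ _ := hC _ (by positivity)
  have hσ : avgW Q (ballWeight n) ≤
      ENNReal.ofReal (volume.real (Metric.ball (0 : Rn n) 1) / Q.vol) := by
    rw [ENNReal.ofReal_div_of_pos hV]
    refine ENNReal.div_le_div_right ?_ _
    rw [ofReal_measureReal measure_ball_lt_top.ne, ← lintegral_ballWeight]
    exact setLIntegral_le_lintegral _ _
  set b := volume.real (Metric.ball (0 : Rn n) 1)
  have hb : 0 ≤ b := measureReal_nonneg
  unfold ApqQ
  calc _ ≤ ENNReal.ofReal (Q.vol ^ (α / n + 1 / q - 1 / p)) *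
        ENNReal.ofReal (C * (3 * Q.side) ^ ((n - α) * q) / Q.vol) ^ (1 / q) *
        ENNReal.ofReal (b / Q.vol) ^ (1 / conjExp p) := by gcongr
    _ = ENNReal.ofReal (Q.vol ^ (α / n + 1 / q - 1 / p) *
        (C * (3 * Q.side) ^ ((n - α) * q) / Q.vol) ^ (1 / q) *
        (b / Q.vol) ^ (1 / conjExp p)) := by
      rw [ENNReal.ofReal_rpow_of_nonneg (by positivity) hq'.le,
        ENNReal.ofReal_rpow_of_nonneg (by positivity) hp'.le,
        ← ENNReal.ofReal_mul (by positivity), ← ENNReal.ofReal_mul (by positivity)]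
    _ = _ := by
      congr 1
      rw [Real.mul_rpow (by norm_num) hL.le, ← mul_assoc,
        Real.div_rpow (by positivity) hV.le, Real.div_rpow hb hV.le,
        Real.mul_rpow (by positivity) (by positivity), ← Real.rpow_mul hL.le]
      have hvr : ∀ t : ℝ, Q.vol ^ t = Q.side ^ (n * t) := fun t => by
        rw [Cube.vol, ← Real.rpow_natCast, ← Real.rpow_mul hL.le]
      simp only [hvr]
      have hcancel : Q.side ^ (n * (α / n + 1 / q - 1 / p)) * Q.side ^ ((n - α) * q * (1 / q)) =
          Q.side ^ (n * (1 / q)) * Q.side ^ (n * (1 / conjExp p)) := by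
        rw [← Real.rpow_add hL, ← Real.rpow_add hL]
        congr 1
        have : p - 1 ≠ 0 := by linarith
        have : p ≠ 0 := by linarith
        have : (n : ℝ) ≠ 0 := by positivity
        unfold conjExp
        field_simp
        ring
      have h1 : Q.side ^ (n * (1 / q)) ≠ 0 := by positivity
      have h2 : Q.side ^ (n * (1 / conjExp p)) ≠ 0 := by positivity
      generalize Q.side ^ (n * (1 / q)) = A at *
      generalize Q.side ^ (n * (1 / conjExp p)) = B at *
      generalize Q.side ^ (n * (α / n + 1 / q - 1 / p)) = D at *
      generalize Q.side ^ ((n - α) * q * (1 / q)) = E at *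
      field_simp
      linear_combination b ^ (1 / conjExp p) * hcancel

lemma fracMax_ballWeight_ge {n : ℕ} (hn : 0 < n) (α : ℝ) {x : Rn n} (hx : 2 ≤ ‖x‖) :
    ENNReal.ofReal ((3 * ‖x‖) ^ (α - n)) * volume (Metric.ball (0 : Rn n) 1) ≤
      fracMax α (mulW (fun _ => 1) (ballWeight n)) x := by
  have hpos : 0 < ‖x‖ := by linarith
  let Q : Cube n := ⟨fun _ => -‖x‖, 3 * ‖x‖, by positivity⟩
  have hmem : ∀ y : Rn n, ‖y‖ ≤ ‖x‖ → y ∈ Q.set := by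
    intro y hy i
    have h := (norm_le_pi_norm y i).trans hy
    rw [Real.norm_eq_abs, abs_le] at h
    exact ⟨h.1, by simp only [Q]; linarith⟩
  refine le_trans ?_ (le_iSup₂_of_le Q (hmem x le_rfl) le_rfl)
  have hvol : Q.vol ^ (α / n - 1) = (3 * ‖x‖) ^ (α - n) := by
    rw [Cube.vol, ← Real.rpow_natCast, ← Real.rpow_mul Q.side_pos.le]
    congr 1
    have : (n : ℝ) ≠ 0 := by positivity
    field_simp
  rw [hvol]
  gcongr
  simp only [mulW, one_mul, ofReal_ballWeight]
  rw [setLIntegral_indicator measurableSet_ball]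
  simp only [Pi.one_apply, setLIntegral_one]
  refine measure_mono (subset_inter subset_rfl fun y hy => hmem y ?_)
  rw [mem_ball_zero_iff] at hy
  linarith

/-- Example: `A^α_{p,q}` is not sufficient for the strong type:
for every `0 < α < n` and `1 < p ≤ q < ∞` there is a pair of weights `(u,σ)` with
`[u,σ]_{A^α_{p,q}} < ∞` and a nonnegative `f ∈ L^p(σ)` with `M_α(fσ) ∉ L^q(u)`. -/
theorem stmt9 (n : ℕ) (hn : 0 < n) (α p q : ℝ) (hα : 0 < α) (hαn : α < n)
    (hp : 1 < p) (hpq : p ≤ q) :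
    ∃ (u σ : Rn n → ℝ) (f : Rn n → ℝ≥0∞),
      IsWeight u ∧ IsWeight σ ∧ Apq α p q u σ < ∞ ∧
      Measurable f ∧ LpW f p σ < ∞ ∧
      (∫⁻ x, fracMax α (mulW f σ) x ^ q * ENNReal.ofReal (u x)) = ∞ := by
  have hq : 0 < q := by linarith
  have hs : 0 < (n - α) * q := mul_pos (by linarith) hq
  obtain ⟨C, hC0, hC⟩ := exists_lintegral_ball_norm_rpow_le hn hs
  refine ⟨tailWeight n ((n - α) * q), ballWeight n, fun _ => 1, isWeight_tailWeight hn hs,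
    isWeight_ballWeight n, ?_, measurable_const, ?_, ?_⟩
  · exact (iSup_le fun Q => apqQ_tailWeight_ballWeight_le hn hp hq hC0 hC Q).trans_lt
      ENNReal.ofReal_lt_top
  · simp only [LpW, ENNReal.one_rpow, one_mul, lintegral_ballWeight]
    exact ENNReal.rpow_lt_top_of_nonneg (by positivity) measure_ball_lt_top.ne
  · set b := volume (Metric.ball (0 : Rn n) 1)
    have hb0 : b ≠ 0 := (Metric.measure_ball_pos _ _ one_pos).ne'
    set c := ENNReal.ofReal (3 ^ ((α - n) * q)) * b ^ q with hc
    have hc0 : c ≠ 0 := by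
      refine mul_ne_zero (by simpa using by positivity) ?_
      simp [ENNReal.rpow_eq_zero_iff, hb0, hq.le]
    have hct : c ≠ ∞ := ENNReal.mul_ne_top ENNReal.ofReal_ne_top
      (ENNReal.rpow_lt_top_of_nonneg hq.le measure_ball_lt_top.ne).ne
    rw [eq_top_iff]
    calc (∞ : ℝ≥0∞) = c * ∫⁻ x in {x : Rn n | 2 ≤ ‖x‖}, ENNReal.ofReal (‖x‖ ^ (-n : ℝ)) := by
          rw [lintegral_norm_rpow_neg_compl_ball hn, ENNReal.mul_top hc0]
      _ = ∫⁻ x in {x : Rn n | 2 ≤ ‖x‖}, c * ENNReal.ofReal (‖x‖ ^ (-n : ℝ)) :=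
          (lintegral_const_mul' _ _ hct).symm
      _ ≤ ∫⁻ x in {x : Rn n | 2 ≤ ‖x‖}, fracMax α (mulW (fun _ => 1) (ballWeight n)) x ^ q *
            ENNReal.ofReal (tailWeight n ((n - α) * q) x) := by
          refine setLIntegral_mono' (measurableSet_two_le_norm n) fun x hx => ?_
          have hx2 : 2 ≤ ‖x‖ := hx
          have hpos : 0 < ‖x‖ := by linarith
          calc c * ENNReal.ofReal (‖x‖ ^ (-n : ℝ))
              = (ENNReal.ofReal ((3 * ‖x‖) ^ (α - n)) * b) ^ q *
                  ENNReal.ofReal (tailWeight n ((n - α) * q) x) := by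
                have e1 : (3 * ‖x‖) ^ ((α - n) * q) * ‖x‖ ^ ((n - α) * q - n) =
                    3 ^ ((α - n) * q) * ‖x‖ ^ (-n : ℝ) := by
                  rw [Real.mul_rpow (by norm_num) hpos.le, mul_assoc, ← Real.rpow_add hpos]
                  congr 2
                  ring
                rw [ENNReal.mul_rpow_of_nonneg _ _ hq.le,
                  ENNReal.ofReal_rpow_of_nonneg (by positivity) hq.le,
                  ← Real.rpow_mul (by positivity), tailWeight, indicator_of_mem hx,
                  mul_right_comm (ENNReal.ofReal ((3 * ‖x‖) ^ ((α - n) * q))),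
                  ← ENNReal.ofReal_mul (by positivity), e1, ENNReal.ofReal_mul (by positivity), hc]
                ring
            _ ≤ _ := by
                gcongr
                exact fracMax_ballWeight_ge hn α hx2
      _ ≤ _ := setLIntegral_le_lintegral _ _
end
end
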